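/- Let (G, C0, φ0) be a minimal counterexample to the extension theorem, with G embedded in the plane so that C0 bounds the outer face. Then an internal (3,3,3,3,3,4)-face of G cannot share a (3,4)-edge with an internal face of length at most 5 in which all vertices except the common 4-vertex are 3-vertices. (A (3,4)-edge is an edge whose endpoints have degrees 3 and 4.) -/

import Mathlib

open SimpleGraph

namespace IFPaper

variable {V : Type}

/-- An `(I,F)`-coloring of a graph, encoded as a Boolean coloring where
`true` means color `I` and `false` means color `F`:  the `I`-colored vertices
form an independent set and the `F`-colored vertices induce a forest
(no cycle has all of its vertices colored `F`). -/
def IFColoring (G : SimpleGraph V) (c : V → Bool) : Prop :=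
  (∀ ⦃u v : V⦄, G.Adj u v → c u = true → c v = false) ∧
  (∀ (v : V) (w : G.Walk v v), w.IsCycle → ¬ (∀ x ∈ w.support, c x = false))

/-- A graph is `(I,F)`-colorable if it admits an `(I,F)`-coloring. -/
def IFColorable (G : SimpleGraph V) : Prop := ∃ c : V → Bool, IFColoring G c

/-- An `(I,F)`-coloring of the subgraph of `G` induced on the set `S`. -/
def IFColoringOn (G : SimpleGraph V) (S : Set V) (c : V → Bool) : Prop :=
  (∀ ⦃u v : V⦄, u ∈ S → v ∈ S → G.Adj u v → c u = true → c v = false) ∧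
  (∀ (v : V) (w : G.Walk v v), w.IsCycle → (∀ x ∈ w.support, x ∈ S) →
    ¬ (∀ x ∈ w.support, c x = false))

/-- A splitting `F`-path of (the vertex set `Q` of) a cycle: a path all of whose
vertices get color `F`, whose two endpoints lie on `Q`, and all of whose other
vertices (at least one) do not lie on `Q`. -/
def IsSplittingFPath (G : SimpleGraph V) (Q : Set V) (c : V → Bool)
    {a b : V} (p : G.Walk a b) : Prop :=
  p.IsPath ∧ (∀ x ∈ p.support, c x = false) ∧ a ∈ Q ∧ b ∈ Q ∧ 2 ≤ p.length ∧
  ∀ x ∈ p.support, x ≠ a → x ≠ b → x ∉ Q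

/-- A super IF-coloring of `(G, Q)`: an `(I,F)`-coloring of `G` with no
splitting `F`-path of `Q`. -/
def SuperIFColoring (G : SimpleGraph V) (Q : Set V) (c : V → Bool) : Prop :=
  IFColoring G c ∧ ∀ (a b : V) (p : G.Walk a b), ¬ IsSplittingFPath G Q c p

/-- `d* ≥ 3`: any two distinct cycles of length at most `5` are at distance at
least `3`. -/
def Cycles5Apart (G : SimpleGraph V) : Prop :=
  ∀ ⦃u v : V⦄ (c1 : G.Walk u u) (c2 : G.Walk v v),
    c1.IsCycle → c2.IsCycle → c1.length ≤ 5 → c2.length ≤ 5 →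
    {e : Sym2 V | e ∈ c1.edges} ≠ {e : Sym2 V | e ∈ c2.edges} →
    ∀ x ∈ c1.support, ∀ y ∈ c2.support, 3 ≤ G.dist x y

/-- A claw of the cycle `C`: a vertex not on `C` with three neighbors on `C`. -/
def HasClaw (G : SimpleGraph V) {v : V} (C : G.Walk v v) : Prop :=
  ∃ x : V, x ∉ C.support ∧ ∃ a b c : V, a ∈ C.support ∧ b ∈ C.support ∧ c ∈ C.support ∧
    a ≠ b ∧ a ≠ c ∧ b ≠ c ∧ G.Adj x a ∧ G.Adj x b ∧ G.Adj x c

/-- A triclaw of the cycle `C`: a triangle `x y z` disjoint from `C`, joined by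
three edges to three distinct vertices of `C`. -/
def HasTriclaw (G : SimpleGraph V) {v : V} (C : G.Walk v v) : Prop :=
  ∃ x y z : V, x ∉ C.support ∧ y ∉ C.support ∧ z ∉ C.support ∧
    G.Adj x y ∧ G.Adj y z ∧ G.Adj x z ∧
    ∃ a b c : V, a ∈ C.support ∧ b ∈ C.support ∧ c ∈ C.support ∧
      a ≠ b ∧ a ≠ c ∧ b ≠ c ∧ G.Adj x a ∧ G.Adj y b ∧ G.Adj z c

/-- A bad cycle is a `9`-cycle having a claw or a triclaw. -/
def IsBadCycle (G : SimpleGraph V) {v : V} (C : G.Walk v v) : Prop :=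
  C.IsCycle ∧ C.length = 9 ∧ (HasClaw G C ∨ HasTriclaw G C)

/-- A good cycle is a cycle that is not bad. -/
def IsGoodCycle (G : SimpleGraph V) {v : V} (C : G.Walk v v) : Prop :=
  C.IsCycle ∧ ¬ IsBadCycle G C

/-- The interior of an arc parametrized by `[0,1]`. -/
def ArcInterior (γ : ℝ → ℝ × ℝ) : Set (ℝ × ℝ) := γ '' Set.Ioo 0 1

/-- The image of an arc parametrized by `[0,1]`. -/
def ArcImage (γ : ℝ → ℝ × ℝ) : Set (ℝ × ℝ) := γ '' Set.Icc 0 1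

/-- A plane embedding of a simple graph: an injective placement of the vertices
in the plane together with, for every edge, a simple arc joining the images of
its endpoints, such that arcs meet only at common endpoints and no arc passes
through a vertex. -/
structure IsPlaneEmbedding (G : SimpleGraph V) (vtx : V → ℝ × ℝ)
    (arc : V → V → ℝ → ℝ × ℝ) : Prop where
  vtx_inj : Function.Injective vtx
  arc_cont : ∀ ⦃u v : V⦄, G.Adj u v → ContinuousOn (arc u v) (Set.Icc 0 1)
  arc_injOn : ∀ ⦃u v : V⦄, G.Adj u v → Set.InjOn (arc u v) (Set.Icc 0 1)
  arc_start : ∀ ⦃u v : V⦄, G.Adj u v → arc u v 0 = vtx u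
  arc_end : ∀ ⦃u v : V⦄, G.Adj u v → arc u v 1 = vtx v
  arc_symm : ∀ ⦃u v : V⦄, G.Adj u v → ∀ t : ℝ, arc v u t = arc u v (1 - t)
  arc_avoids_vtx : ∀ ⦃u v : V⦄, G.Adj u v → ∀ w : V, vtx w ∉ ArcInterior (arc u v)
  arc_disjoint : ∀ ⦃u v u' v' : V⦄, G.Adj u v → G.Adj u' v' → s(u, v) ≠ s(u', v') →
    ArcInterior (arc u v) ∩ ArcInterior (arc u' v') = ∅

/-- A graph is planar if it admits a plane embedding. -/
def IsPlanarGraph (G : SimpleGraph V) : Prop :=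
  ∃ (vtx : V → ℝ × ℝ) (arc : V → V → ℝ → ℝ × ℝ), IsPlaneEmbedding G vtx arc

/-- The subset of the plane covered by a plane drawing of `G`. -/
def Drawing (G : SimpleGraph V) (vtx : V → ℝ × ℝ) (arc : V → V → ℝ → ℝ × ℝ) :
    Set (ℝ × ℝ) :=
  Set.range vtx ∪ ⋃ (u : V) (v : V) (_ : G.Adj u v), ArcImage (arc u v)

/-- The subset of the plane covered by the drawing of a walk `w`. -/
def WalkDrawing (G : SimpleGraph V) (arc : V → V → ℝ → ℝ × ℝ)
    {a b : V} (w : G.Walk a b) : Set (ℝ × ℝ) :=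
  ⋃ (u : V) (v : V) (_ : G.Adj u v) (_ : s(u, v) ∈ w.edges), ArcImage (arc u v)

/-- A face of a plane drawing: a connected component of the complement of the
drawing. -/
def IsFace (G : SimpleGraph V) (vtx : V → ℝ × ℝ) (arc : V → V → ℝ → ℝ × ℝ)
    (f : Set (ℝ × ℝ)) : Prop :=
  ∃ p : ℝ × ℝ, p ∉ Drawing G vtx arc ∧
    f = connectedComponentIn (Drawing G vtx arc)ᶜ p

/-- The outer face: the unbounded face. -/
def IsOuterFace (G : SimpleGraph V) (vtx : V → ℝ × ℝ) (arc : V → V → ℝ → ℝ × ℝ)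
    (f : Set (ℝ × ℝ)) : Prop :=
  IsFace G vtx arc f ∧ ¬ Bornology.IsBounded f

/-- A vertex is on a face if its image lies on the boundary of the face. -/
def VertexOnFace (vtx : V → ℝ × ℝ) (f : Set (ℝ × ℝ)) (v : V) : Prop :=
  vtx v ∈ frontier f

/-- The face `f` is bounded by the (closed) walk `w`. -/
def FaceBoundedBy (G : SimpleGraph V) (vtx : V → ℝ × ℝ) (arc : V → V → ℝ → ℝ × ℝ)
    (f : Set (ℝ × ℝ)) {a : V} (w : G.Walk a a) : Prop :=
  IsFace G vtx arc f ∧ frontier f = WalkDrawing G arc w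

/-- A vertex lies (strictly) inside the cycle `C` of the plane graph. -/
def VertexInsideCycle (G : SimpleGraph V) (vtx : V → ℝ × ℝ)
    (arc : V → V → ℝ → ℝ × ℝ) {a : V} (C : G.Walk a a) (v : V) : Prop :=
  vtx v ∉ WalkDrawing G arc C ∧
  Bornology.IsBounded (connectedComponentIn (WalkDrawing G arc C)ᶜ (vtx v))

/-- A vertex lies (strictly) outside the cycle `C` of the plane graph. -/
def VertexOutsideCycle (G : SimpleGraph V) (vtx : V → ℝ × ℝ)
    (arc : V → V → ℝ → ℝ × ℝ) {a : V} (C : G.Walk a a) (v : V) : Prop :=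
  vtx v ∉ WalkDrawing G arc C ∧
  ¬ Bornology.IsBounded (connectedComponentIn (WalkDrawing G arc C)ᶜ (vtx v))

/-- A cycle of a plane graph is separating if its interior and its exterior
each contain a vertex of the graph. -/
def IsSeparatingCycle (G : SimpleGraph V) (vtx : V → ℝ × ℝ)
    (arc : V → V → ℝ → ℝ × ℝ) {a : V} (C : G.Walk a a) : Prop :=
  (∃ v : V, VertexInsideCycle G vtx arc C v) ∧
  (∃ v : V, VertexOutsideCycle G vtx arc C v)

/-- The cycle `C` has no chord in `G`. -/
def Chordless (G : SimpleGraph V) {a : V} (C : G.Walk a a) : Prop :=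
  ∀ ⦃u v : V⦄, u ∈ C.support → v ∈ C.support → G.Adj u v → s(u, v) ∈ C.edges

/-- The precoloring `c0` of the cycle `C0` extends to a super IF-coloring of
`(G, C0)`. -/
def ExtendsToSuper (G : SimpleGraph V) {v0 : V} (C0 : G.Walk v0 v0)
    (c0 : V → Bool) : Prop :=
  ∃ c : V → Bool, SuperIFColoring G {x | x ∈ C0.support} c ∧
    ∀ x ∈ C0.support, c x = c0 x

/-- A counterexample to the extension theorem: a planar graph with `d* ≥ 3`, a
good cycle `C0` of length at most `9`, and an `(I,F)`-coloring of `G[V(C0)]`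
which does not extend to a super IF-coloring of `(G, C0)`. -/
def IsCounterexample (G : SimpleGraph V) {v0 : V} (C0 : G.Walk v0 v0)
    (c0 : V → Bool) : Prop :=
  IsPlanarGraph G ∧ Cycles5Apart G ∧ IsGoodCycle G C0 ∧ C0.length ≤ 9 ∧
  IFColoringOn G {x | x ∈ C0.support} c0 ∧ ¬ ExtendsToSuper G C0 c0

/-- The quantity `|V(G)| + |E(G)|`. -/
noncomputable def graphSize {V : Type} [Fintype V] (G : SimpleGraph V) : ℕ :=
  Fintype.card V + G.edgeSet.ncard

/-- A minimal counterexample to the extension theorem: one minimizing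
`|V(G)| + |E(G)|` among all counterexamples. -/
def IsMinimalCounterexample [Fintype V] (G : SimpleGraph V) {v0 : V}
    (C0 : G.Walk v0 v0) (c0 : V → Bool) : Prop :=
  IsCounterexample G C0 c0 ∧
  ∀ (n : ℕ) (G' : SimpleGraph (Fin n)) (v0' : Fin n) (C0' : G'.Walk v0' v0')
    (c0' : Fin n → Bool), IsCounterexample G' C0' c0' →
      graphSize G ≤ graphSize G'

/-- A chord of the cycle `C` splitting it into two cycles of lengths `l1` and
`l2`: an edge between two non-consecutive vertices of `C` together with two
cycles of lengths `l1` and `l2` which both use the chord, use otherwise only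
edges of `C`, and together partition the edges of `C`. -/
def HasChordSplit (G : SimpleGraph V) {a : V} (C : G.Walk a a) (l1 l2 : ℕ) : Prop :=
  ∃ u v : V, u ∈ C.support ∧ v ∈ C.support ∧ G.Adj u v ∧ s(u, v) ∉ C.edges ∧
    ∃ (c1 c2 : G.Walk u u), c1.IsCycle ∧ c2.IsCycle ∧
      c1.length = l1 ∧ c2.length = l2 ∧
      s(u, v) ∈ c1.edges ∧ s(u, v) ∈ c2.edges ∧
      (∀ e ∈ c1.edges, e ≠ s(u, v) → e ∈ C.edges) ∧
      (∀ e ∈ c2.edges, e ≠ s(u, v) → e ∈ C.edges) ∧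
      (∀ e ∈ C.edges, (e ∈ c1.edges ↔ e ∉ c2.edges))

/-- A `(l1, l2, l3)`-claw of the cycle `C`: a claw which together with `C`
forms three cycles of lengths `l1`, `l2` and `l3`. -/
def HasClawSplit (G : SimpleGraph V) {a : V} (C : G.Walk a a) (l1 l2 l3 : ℕ) : Prop :=
  ∃ x : V, x ∉ C.support ∧ ∃ v1 v2 v3 : V,
    v1 ∈ C.support ∧ v2 ∈ C.support ∧ v3 ∈ C.support ∧
    v1 ≠ v2 ∧ v1 ≠ v3 ∧ v2 ≠ v3 ∧ G.Adj x v1 ∧ G.Adj x v2 ∧ G.Adj x v3 ∧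
    ∃ (w1 w2 w3 : G.Walk x x), w1.IsCycle ∧ w2.IsCycle ∧ w3.IsCycle ∧
      w1.length = l1 ∧ w2.length = l2 ∧ w3.length = l3 ∧
      (∀ e ∈ w1.edges, e ∈ C.edges ∨ e = s(x, v1) ∨ e = s(x, v2) ∨ e = s(x, v3)) ∧
      (∀ e ∈ w2.edges, e ∈ C.edges ∨ e = s(x, v1) ∨ e = s(x, v2) ∨ e = s(x, v3)) ∧
      (∀ e ∈ w3.edges, e ∈ C.edges ∨ e = s(x, v1) ∨ e = s(x, v2) ∨ e = s(x, v3)) ∧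
      (∀ e ∈ C.edges, (e ∈ w1.edges ∧ e ∉ w2.edges ∧ e ∉ w3.edges) ∨
        (e ∉ w1.edges ∧ e ∈ w2.edges ∧ e ∉ w3.edges) ∨
        (e ∉ w1.edges ∧ e ∉ w2.edges ∧ e ∈ w3.edges))

/-- A special `9`-cycle: a `9`-cycle having a `(3,8)`-chord or a
`(5,5,5)`-claw. -/
def IsSpecial9Cycle (G : SimpleGraph V) {a : V} (C : G.Walk a a) : Prop :=
  C.IsCycle ∧ C.length = 9 ∧ (HasChordSplit G C 3 8 ∨ HasClawSplit G C 5 5 5)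

/-- Two cycles are normally adjacent if they share exactly one edge and
exactly two vertices. -/
def NormallyAdjacent (G : SimpleGraph V) {a b : V}
    (c1 : G.Walk a a) (c2 : G.Walk b b) : Prop :=
  (∃ e : Sym2 V, {e' : Sym2 V | e' ∈ c1.edges} ∩ {e' : Sym2 V | e' ∈ c2.edges} = {e}) ∧
  (∃ x y : V, x ≠ y ∧ {z : V | z ∈ c1.support} ∩ {z : V | z ∈ c2.support} = {x, y})

/-- A `3`-fold cover `(H, L)` of `G`. -/
def IsDPCover (G : SimpleGraph V) {W : Type} (H : SimpleGraph W)
    (L : V → Finset W) : Prop :=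
  (∀ v : V, (L v).card = 3) ∧
  (∀ ⦃u v : V⦄, u ≠ v → Disjoint (L u) (L v)) ∧
  (∀ v : V, ∀ a ∈ L v, ∀ b ∈ L v, ¬ H.Adj a b) ∧
  (∀ ⦃a b : W⦄, H.Adj a b → ∃ u v : V, G.Adj u v ∧ a ∈ L u ∧ b ∈ L v) ∧
  (∀ ⦃u v : V⦄, u ≠ v → ∀ a ∈ L u, ∀ b ∈ L v, ∀ b' ∈ L v,
    H.Adj a b → H.Adj a b' → b = b')

/-- `G` is DP-`3`-colorable: for every `3`-fold cover `(H, L)` of `G` there is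
an independent transversal picking one vertex from each fiber. -/
def DP3Colorable (G : SimpleGraph V) : Prop :=
  ∀ (W : Type) (H : SimpleGraph W) (L : V → Finset W), IsDPCover G H L →
    ∃ f : V → W, (∀ v : V, f v ∈ L v) ∧ ∀ u v : V, ¬ H.Adj (f u) (f v)

/-- A preconnected set meeting an open set but not its frontier lies in that open set. -/
lemma subset_of_disjoint_frontier {X : Type*} [TopologicalSpace X] {T D : Set X}
    (hT : IsPreconnected T) (hD : IsOpen D) (hTD : (T ∩ D).Nonempty)
    (hfr : Disjoint T (frontier D)) : T ⊆ D := by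
  refine hT.subset_of_closure_inter_subset hD hTD ?_
  rintro z ⟨hz, hzT⟩
  by_contra hzD
  exact hfr.le_bot ⟨hzT, by rw [hD.frontier_eq]; exact ⟨hz, hzD⟩⟩

/-- Two points lie in a common preconnected subset of the complement of `K`. -/
def Unseparated {X : Type*} [TopologicalSpace X] (K : Set X) (p q : X) : Prop :=
  ∃ T : Set X, IsPreconnected T ∧ Disjoint T K ∧ p ∈ T ∧ q ∈ T

lemma eq_of_exp_eq_one {X : Type*} [TopologicalSpace X] {T : Set X} (hT : IsPreconnected T)
    {f : X → ℂ} (hf : ContinuousOn f T) (h1 : ∀ z ∈ T, Complex.exp (f z) = 1)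
    {x y : X} (hx : x ∈ T) (hy : y ∈ T) : f x = f y := by
  have hc : (Set.range fun n : ℤ => (n : ℂ) * (2 * Real.pi * Complex.I)).Countable :=
    Set.countable_range _
  refine hc.isTotallyDisconnected _ ?_ (hT.image f hf) ⟨x, hx, rfl⟩ ⟨y, hy, rfl⟩
  rintro _ ⟨z, hz, rfl⟩
  obtain ⟨n, hn⟩ := Complex.exp_eq_one_iff.1 (h1 z hz)
  exact ⟨n, hn.symm⟩

lemma exists_continuous_log {F : ℂ → ℂ} (hF : Continuous F) (h0 : ∀ z, F z ≠ 0) :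
    ∃ L : ℂ → ℂ, Continuous L ∧ ∀ z, Complex.exp (L z) = F z := by
  obtain ⟨f, ⟨-, hf⟩, -⟩ := Complex.isCoveringMapOn_exp.existsUnique_continuousMap_lifts
    ⟨F, hF⟩ (a₀ := 0) (Complex.exp_log (h0 0)) h0
  exact ⟨f, f.continuous, fun z => congrFun hf z⟩

/-- The ratio `(z - p) / (z - q)` has a continuous logarithm on `K`. -/
def HasLogRatio (K : Set ℂ) (p q : ℂ) : Prop :=
  ∃ h : ℂ → ℂ, ContinuousOn h K ∧ ∀ z ∈ K, z - p = (z - q) * Complex.exp (h z)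

lemma HasLogRatio.symm {K : Set ℂ} {p q : ℂ} (h : HasLogRatio K p q) : HasLogRatio K q p := by
  obtain ⟨f, hf, hz⟩ := h
  refine ⟨fun z => -f z, hf.neg, fun z hzK => ?_⟩
  rw [hz z hzK, mul_assoc, ← Complex.exp_add]
  simp

lemma HasLogRatio.trans {K : Set ℂ} {p q r : ℂ} (h : HasLogRatio K p q)
    (h' : HasLogRatio K q r) : HasLogRatio K p r := by
  obtain ⟨f, hf, hz⟩ := h
  obtain ⟨g, hg, hz'⟩ := h'
  refine ⟨fun z => g z + f z, hg.add hf, fun z hzK => ?_⟩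
  rw [hz z hzK, hz' z hzK, mul_assoc, ← Complex.exp_add]

lemma hasLogRatio_of_ball {K : Set ℂ} {p q : ℂ} {r : ℝ} (hK : Disjoint (Metric.ball p r) K)
    (hq : q ∈ Metric.ball p r) : HasLogRatio K q p := by
  have hz0 : ∀ z ∈ K, z - p ≠ 0 := by
    intro z hz h
    rw [sub_eq_zero] at h
    subst h
    exact hK.le_bot ⟨Metric.mem_ball_self (dist_nonneg.trans_lt (Metric.mem_ball.1 hq)), hz⟩
  have hslit : ∀ z ∈ K, (z - q) / (z - p) ∈ Complex.slitPlane := by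
    intro z hz
    have hzr : r ≤ dist z p := by
      by_contra hlt
      exact hK.le_bot ⟨Metric.mem_ball.2 (not_le.1 hlt), hz⟩
    have hlt : ‖(p - q) / (z - p)‖ < 1 := by
      rw [norm_div, div_lt_one (norm_pos_iff.2 (hz0 z hz))]
      rw [Metric.mem_ball, _root_.dist_comm, dist_eq_norm] at hq
      rw [dist_eq_norm] at hzr
      linarith
    have heq : (z - q) / (z - p) = 1 + (p - q) / (z - p) := by
      have := hz0 z hz
      field_simp
      ring
    rw [heq]
    exact Complex.mem_slitPlane_of_norm_lt_one hlt
  refine ⟨fun z => Complex.log ((z - q) / (z - p)), ?_, fun z hz => ?_⟩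
  · refine ContinuousOn.clog ?_ hslit
    exact ContinuousOn.div (by fun_prop) (by fun_prop) hz0
  · have h1 := Complex.slitPlane_ne_zero (hslit z hz)
    rw [Complex.exp_log h1]
    have := hz0 z hz
    field_simp

lemma Unseparated.hasLogRatio {K : Set ℂ} (hK : IsClosed K) {p q : ℂ}
    (h : Unseparated K p q) : HasLogRatio K p q := by
  obtain ⟨T, hT, hTK, hp, hq⟩ := h
  refine hT.induction₂ (HasLogRatio K) (fun x hx => ?_)
    (fun x y z _ _ _ h h' => h.trans h') (fun x y _ _ h => h.symm) hp hq
  have hx' : x ∈ Kᶜ := fun hxK => hTK.le_bot ⟨hx, hxK⟩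
  obtain ⟨r, hr, hrK⟩ := Metric.isOpen_iff.1 hK.isOpen_compl x hx'
  have hd : Disjoint (Metric.ball x r) K := Set.disjoint_left.2 hrK
  filter_upwards [mem_nhdsWithin_of_mem_nhds (Metric.ball_mem_nhds x hr)] with y hy
  exact (hasLogRatio_of_ball hd hy).symm

lemma frontier_connectedComponentIn_compl_subset {X : Type*} [TopologicalSpace X]
    [LocallyConnectedSpace X] {K : Set X} (hK : IsClosed K) (p : X) :
    frontier (connectedComponentIn Kᶜ p) ⊆ K := by
  intro z hz
  by_contra hzK
  have hU : IsOpen (connectedComponentIn Kᶜ p) := hK.isOpen_compl.connectedComponentIn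
  have hV : IsOpen (connectedComponentIn Kᶜ z) := hK.isOpen_compl.connectedComponentIn
  rw [hU.frontier_eq] at hz
  obtain ⟨w, hw, hw'⟩ := mem_closure_iff.1 hz.1 _ hV (mem_connectedComponentIn hzK)
  apply hz.2
  rw [connectedComponentIn_eq hw', ← connectedComponentIn_eq hw]
  exact mem_connectedComponentIn hzK

lemma not_exists_log_on_circle {L : ℂ → ℂ} (hL : Continuous L) {p : ℂ} {R : ℝ} (hR : 0 < R)
    (h : ∀ z, ‖z - p‖ = R → Complex.exp (L z) = z - p) : False := by
  let γ : ℝ → ℂ := fun θ => p + R * Complex.exp (θ * Complex.I)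
  have hγ : Continuous γ := by fun_prop
  let g : ℝ → ℂ := fun θ => L (γ θ) - θ * Complex.I - Real.log R
  have hg : Continuous g := by fun_prop
  have h1 : ∀ θ ∈ Set.univ, Complex.exp (g θ) = 1 := by
    intro θ _
    have hR' : (R : ℂ) ≠ 0 := by exact_mod_cast hR.ne'
    have hexp : Complex.exp (L (γ θ)) = R * Complex.exp (θ * Complex.I) := by
      rw [h (γ θ) (by simp [γ, Complex.norm_exp_ofReal_mul_I, abs_of_pos hR])]
      simp [γ]
    simp only [g]
    rw [Complex.exp_sub, Complex.exp_sub, hexp, ← Complex.ofReal_exp, Real.exp_log hR]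
    have := Complex.exp_ne_zero (θ * Complex.I)
    field_simp
  have h2 := eq_of_exp_eq_one isPreconnected_univ hg.continuousOn h1
    (Set.mem_univ 0) (Set.mem_univ (2 * Real.pi))
  have h3 : γ (2 * Real.pi) = γ 0 := by simp [γ]
  simp only [g, h3] at h2
  refine Complex.two_pi_I_ne_zero ?_
  push_cast at h2
  linear_combination h2

lemma not_hasLogRatio_of_bounded {K : Set ℂ} (hK : IsCompact K) {p q : ℂ} (hp : p ∉ K)
    (hq : q ∉ connectedComponentIn Kᶜ p)
    (hb : Bornology.IsBounded (connectedComponentIn Kᶜ p)) (hqK : q ∉ K) :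
    ¬ HasLogRatio K p q := by
  classical
  rintro ⟨h, hh, hpq⟩
  set U := connectedComponentIn Kᶜ p with hUdef
  have hpU : p ∈ U := mem_connectedComponentIn hp
  have hUK : frontier U ⊆ K := frontier_connectedComponentIn_compl_subset hK.isClosed p
  have hqcl : q ∉ closure U := by
    rw [closure_eq_self_union_frontier]
    rintro (h | h)
    exacts [hq h, hqK (hUK h)]
  obtain ⟨H, hH⟩ := ContinuousMap.exists_restrict_eq hK.isClosed
    (⟨K.domRestrict h, hh.domRestrict⟩ : C(K, ℂ))
  have hH' : ∀ z ∈ K, H z = h z := fun z hz => DFunLike.congr_fun hH ⟨z, hz⟩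
  let F : ℂ → ℂ := fun z => if z ∈ U then (z - q) * Complex.exp (H z) else z - p
  have hF : Continuous F := by
    refine Continuous.if ?_ (by fun_prop) (by fun_prop)
    intro z hz
    have hzK := hUK hz
    rw [hpq z hzK, hH' z hzK]
  have hF0 : ∀ z, F z ≠ 0 := by
    intro z
    simp only [F]
    split_ifs with hz
    · refine mul_ne_zero (sub_ne_zero.2 ?_) (Complex.exp_ne_zero _)
      rintro rfl
      exact hq hz
    · refine sub_ne_zero.2 ?_
      rintro rfl
      exact hz hpU
  obtain ⟨L, hL, hLF⟩ := exists_continuous_log hF hF0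
  obtain ⟨R, hR0, hR⟩ := hb.subset_ball_lt 0 p
  refine not_exists_log_on_circle hL hR0 (p := p) fun z hz => ?_
  have hzU : z ∉ U := fun hzU => (mem_ball_iff_norm.1 (hR hzU)).ne hz
  rw [hLF]
  simp [F, hzU]

lemma isPreconnected_compl_closedBall (R : ℝ) :
    IsPreconnected (Metric.closedBall (0 : ℂ) R)ᶜ := by
  by_cases hR : 0 ≤ R
  · have : (Metric.closedBall (0 : ℂ) R)ᶜ =
        (fun x : ℝ × ℂ => (x.1 : ℂ) * x.2) '' (Set.Ioi R ×ˢ Metric.sphere 0 1) := by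
      ext z
      simp only [Set.mem_compl_iff, mem_closedBall_zero_iff, not_le, Set.mem_image, Set.mem_prod,
        Set.mem_Ioi, mem_sphere_iff_norm, sub_zero, Prod.exists]
      constructor
      · intro h
        have hz : ‖z‖ ≠ 0 := (hR.trans_lt h).ne'
        refine ⟨‖z‖, z / ‖z‖, ⟨h, by simp [hz]⟩, ?_⟩
        have : ((‖z‖ : ℝ) : ℂ) ≠ 0 := by exact_mod_cast hz
        field_simp
      · rintro ⟨a, w, ⟨ha, hw⟩, rfl⟩
        simp [hw, abs_of_pos (hR.trans_lt ha), ha]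
    rw [this]
    refine IsPreconnected.image ?_ _ (by fun_prop)
    exact isPreconnected_Ioi.prod
      (isPreconnected_sphere (by simp) _ _)
  · rw [Metric.closedBall_eq_empty.2 (not_le.1 hR), Set.compl_empty]
    exact isPreconnected_univ

lemma HasLogRatio.unseparated {K : Set ℂ} (hK : IsCompact K) {p q : ℂ} (hp : p ∉ K)
    (hq : q ∉ K) (h : HasLogRatio K p q) : Unseparated K p q := by
  by_contra hns
  have hUV : ∀ w, w ∈ connectedComponentIn Kᶜ p → w ∉ connectedComponentIn Kᶜ q := by
    intro w hw hw'
    refine hns ⟨connectedComponentIn Kᶜ p, isPreconnected_connectedComponentIn,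
      Set.disjoint_left.2 (connectedComponentIn_subset _ _), mem_connectedComponentIn hp, ?_⟩
    rw [connectedComponentIn_eq hw, ← connectedComponentIn_eq hw']
    exact mem_connectedComponentIn hq
  have hUb : ¬ Bornology.IsBounded (connectedComponentIn Kᶜ p) := fun hb =>
    not_hasLogRatio_of_bounded hK hp (fun h => hUV q h (mem_connectedComponentIn hq)) hb hq h
  have hVb : ¬ Bornology.IsBounded (connectedComponentIn Kᶜ q) := fun hb =>
    not_hasLogRatio_of_bounded hK hq (fun h => hUV p (mem_connectedComponentIn hp) h) hb hp h.symm
  obtain ⟨R, hR⟩ := hK.isBounded.subset_closedBall (0 : ℂ)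
  have key : ∀ s, ¬ Bornology.IsBounded (connectedComponentIn Kᶜ s) →
      (Metric.closedBall (0 : ℂ) R)ᶜ ⊆ connectedComponentIn Kᶜ s := by
    intro s hs
    have : ∃ w ∈ connectedComponentIn Kᶜ s, w ∈ (Metric.closedBall (0 : ℂ) R)ᶜ := by
      by_contra! hcon
      exact hs (Metric.isBounded_closedBall.subset fun w hw => not_not.1 (hcon w hw))
    obtain ⟨w, hw, hwR⟩ := this
    rw [connectedComponentIn_eq hw]
    exact (isPreconnected_compl_closedBall R).subset_connectedComponentIn hwR
      (Set.compl_subset_compl.2 hR)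
  have hne : ((Metric.closedBall (0 : ℂ) R)ᶜ).Nonempty := by
    by_contra hcon
    rw [Set.not_nonempty_iff_eq_empty, Set.compl_empty_iff] at hcon
    exact hUb (Metric.isBounded_closedBall.subset (hcon ▸ Set.subset_univ _))
  obtain ⟨w, hw⟩ := hne
  exact hUV w (key p hUb hw) (key q hVb hw)

lemma janiszewski_complex {K₁ K₂ : Set ℂ} (h1 : IsCompact K₁) (h2 : IsCompact K₂)
    (hc : IsPreconnected (K₁ ∩ K₂)) {p q : ℂ} (hs1 : Unseparated K₁ p q)
    (hs2 : Unseparated K₂ p q) : Unseparated (K₁ ∪ K₂) p q := by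
  classical
  obtain ⟨f, hf, hfe⟩ := hs1.hasLogRatio h1.isClosed
  obtain ⟨g, hg, hge⟩ := hs2.hasLogRatio h2.isClosed
  have hnot : ∀ {K : Set ℂ}, Unseparated K p q → p ∉ K ∧ q ∉ K := by
    rintro K ⟨T, -, hT, hp, hq⟩
    exact ⟨fun h => hT.le_bot ⟨hp, h⟩, fun h => hT.le_bot ⟨hq, h⟩⟩
  refine HasLogRatio.unseparated (h1.union h2) (fun h => h.elim (hnot hs1).1 (hnot hs2).1)
    (fun h => h.elim (hnot hs1).2 (hnot hs2).2) ?_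
  obtain ⟨c, hc1, hc2⟩ : ∃ c : ℂ, Complex.exp c = 1 ∧ ∀ z ∈ K₁ ∩ K₂, f z = g z + c := by
    have h1' : ∀ z ∈ K₁ ∩ K₂, Complex.exp (f z - g z) = 1 := by
      intro z hz
      have hzq : z - q ≠ 0 := by
        rw [sub_ne_zero]
        rintro rfl
        exact (hnot hs1).2 hz.1
      have := (hfe z hz.1).symm.trans (hge z hz.2)
      rw [Complex.exp_sub, mul_left_cancel₀ hzq this, div_self (Complex.exp_ne_zero _)]
    rcases (K₁ ∩ K₂).eq_empty_or_nonempty with he | ⟨w, hw⟩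
    · exact ⟨0, Complex.exp_zero, by simp [he]⟩
    · refine ⟨f w - g w, h1' w hw, fun z hz => ?_⟩
      have := eq_of_exp_eq_one hc ((hf.mono Set.inter_subset_left).sub
        (hg.mono Set.inter_subset_right)) h1' hz hw
      simp only [Pi.sub_apply] at this
      rw [← this]
      ring
  refine ⟨fun z => if z ∈ K₁ then f z else g z + c, ?_, ?_⟩
  · refine ContinuousOn.union_of_isClosed ?_ ?_ h1.isClosed h2.isClosed
    · exact hf.congr fun z hz => by simp [hz]
    · have hgc : ContinuousOn (fun z => g z + c) K₂ := hg.add continuousOn_const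
      refine hgc.congr fun z hz => ?_
      by_cases hz1 : z ∈ K₁
      · simp [hz1, hc2 z ⟨hz1, hz⟩]
      · simp [hz1]
  · rintro z hz
    by_cases hz1 : z ∈ K₁
    · simpa [hz1] using hfe z hz1
    · simpa [hz1, Complex.exp_add, hc1] using hge z (hz.resolve_left hz1)

lemma arc_unseparated_complex {γ : ℝ → ℂ} (hγ : ContinuousOn γ (Set.Icc 0 1))
    (hinj : Set.InjOn γ (Set.Icc 0 1)) {p q : ℂ} (hp : p ∉ γ '' Set.Icc 0 1)
    (hq : q ∉ γ '' Set.Icc 0 1) : Unseparated (γ '' Set.Icc 0 1) p q := by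
  refine HasLogRatio.unseparated (isCompact_Icc.image_of_continuousOn hγ) hp hq ?_
  let π : ℂ → ℝ := fun z => (Set.projIcc (0 : ℝ) 1 zero_le_one z.re : ℝ)
  have hπ : Continuous π := by
    exact continuous_subtype_val.comp (continuous_projIcc.comp Complex.continuous_re)
  have hπm : ∀ z, π z ∈ Set.Icc (0 : ℝ) 1 := fun z => Subtype.property _
  have hγπ : Continuous fun z => γ (π z) := hγ.comp_continuous hπ hπm
  have hne : ∀ {s : ℂ}, s ∉ γ '' Set.Icc 0 1 → ∀ z, γ (π z) - s ≠ 0 := by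
    intro s hs z h
    exact hs ⟨π z, hπm z, sub_eq_zero.1 h⟩
  obtain ⟨L, hL, hLe⟩ := exists_continuous_log (F := fun z => (γ (π z) - p) / (γ (π z) - q))
    ((hγπ.sub continuous_const).div (hγπ.sub continuous_const) (hne hq))
    (fun z => div_ne_zero (hne hp z) (hne hq z))
  have hinv : ContinuousOn (Function.invFunOn γ (Set.Icc 0 1)) (γ '' Set.Icc 0 1) := by
    rw [continuousOn_iff_continuous_domRestrict]
    let e : Set.Icc (0 : ℝ) 1 → ℂ := fun t => γ t
    have he : Topology.IsClosedEmbedding e :=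
      (continuousOn_iff_continuous_domRestrict.1 hγ).isClosedEmbedding
        (Set.injOn_iff_injective.1 hinj)
    have hr : ∀ z : γ '' Set.Icc 0 1, ∃ t : Set.Icc (0 : ℝ) 1, e t = z := by
      rintro ⟨_, t, ht, rfl⟩
      exact ⟨⟨t, ht⟩, rfl⟩
    choose s hs using hr
    have hsc : Continuous s := by
      rw [he.isInducing.continuous_iff]
      have : e ∘ s = Subtype.val := funext hs
      rw [this]
      exact continuous_subtype_val
    have : (γ '' Set.Icc 0 1).domRestrict (Function.invFunOn γ (Set.Icc 0 1)) =
        fun z => (s z : ℝ) := by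
      ext z
      have hz := hs z
      have h1 := hinj.leftInvOn_invFunOn (s z).2
      change γ (s z) = z at hz
      rw [hz] at h1
      exact h1
    rw [this]
    exact continuous_subtype_val.comp hsc
  refine ⟨fun z => L (Function.invFunOn γ (Set.Icc 0 1) z : ℝ), ?_, ?_⟩
  · exact hL.comp_continuousOn (Complex.continuous_ofReal.comp_continuousOn hinv)
  · rintro _ ⟨t, ht, rfl⟩
    have h1 := hinj.leftInvOn_invFunOn ht
    have h2 : π t = t := by
      simp only [π, Complex.ofReal_re]
      rw [Set.projIcc_of_mem _ ht]
    have h3 := hLe t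
    rw [h2] at h3
    have := hne hq t
    rw [h2] at this
    simp only [h1, h3]
    field_simp

lemma Unseparated.mono {X : Type*} [TopologicalSpace X] {K K' : Set X} {p q : X}
    (h : Unseparated K p q) (hK : K' ⊆ K) : Unseparated K' p q := by
  obtain ⟨T, hT, hTK, hp, hq⟩ := h
  exact ⟨T, hT, hTK.mono_right hK, hp, hq⟩

lemma Unseparated.image {X Y : Type*} [TopologicalSpace X] [TopologicalSpace Y] (e : X ≃ₜ Y)
    {K : Set X} {p q : X} (h : Unseparated K p q) : Unseparated (e '' K) (e p) (e q) := by
  obtain ⟨T, hT, hTK, hp, hq⟩ := h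
  exact ⟨e '' T, hT.image e e.continuous.continuousOn,
    (Set.disjoint_image_iff e.injective).2 hTK, ⟨p, hp, rfl⟩, ⟨q, hq, rfl⟩⟩

/-- **Janiszewski's theorem**: if neither of two compact plane sets with connected intersection
separates two points, then their union does not separate them. -/
lemma janiszewski {K₁ K₂ : Set (ℝ × ℝ)} (h1 : IsCompact K₁) (h2 : IsCompact K₂)
    (hc : IsPreconnected (K₁ ∩ K₂)) {p q : ℝ × ℝ} (hs1 : Unseparated K₁ p q)
    (hs2 : Unseparated K₂ p q) : Unseparated (K₁ ∪ K₂) p q := by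
  let e : ℝ × ℝ ≃ₜ ℂ := Complex.equivRealProdCLM.symm.toHomeomorph
  have h := janiszewski_complex (h1.image e.continuous) (h2.image e.continuous)
    (by rw [← Set.image_inter e.injective]; exact hc.image e e.continuous.continuousOn)
    (hs1.image e) (hs2.image e)
  have h' := h.image e.symm
  rw [← Set.image_union] at h'
  simpa [Set.image_image] using h'

/-- A simple arc does not separate the plane. -/
lemma arc_unseparated {γ : ℝ → ℝ × ℝ} (hγ : ContinuousOn γ (Set.Icc 0 1))
    (hinj : Set.InjOn γ (Set.Icc 0 1)) {p q : ℝ × ℝ} (hp : p ∉ ArcImage γ)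
    (hq : q ∉ ArcImage γ) : Unseparated (ArcImage γ) p q := by
  let e : ℝ × ℝ ≃ₜ ℂ := Complex.equivRealProdCLM.symm.toHomeomorph
  have him : (fun t => e (γ t)) '' Set.Icc 0 1 = e '' ArcImage γ := by
    rw [ArcImage, Set.image_image]
  have h := arc_unseparated_complex (γ := fun t => e (γ t)) (p := e p) (q := e q)
    (e.continuous.comp_continuousOn hγ) (e.injective.comp_injOn hinj)
    (by rw [him, e.injective.mem_set_image]; exact hp)
    (by rw [him, e.injective.mem_set_image]; exact hq)
  rw [him] at h
  simpa [Set.image_image] using h.image e.symm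

lemma isPreconnected_union_insert {X : Type*} [TopologicalSpace X] {f₁ f₂ : Set X} {v : X}
    (h1 : IsPreconnected f₁) (h2 : IsPreconnected f₂) (hv1 : v ∈ frontier f₁)
    (hv2 : v ∈ frontier f₂) : IsPreconnected (insert v f₁ ∪ insert v f₂) := by
  refine IsPreconnected.union v (Set.mem_insert _ _) (Set.mem_insert _ _) ?_ ?_
  · exact h1.subset_closure (Set.subset_insert _ _)
      (Set.insert_subset (frontier_subset_closure hv1) subset_closure)
  · exact h2.subset_closure (Set.subset_insert _ _)
      (Set.insert_subset (frontier_subset_closure hv2) subset_closure)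

/-- A compact connected set reaching from the corner `c` into `K` along the component `g`. -/
lemma exists_connection {K P g : Set (ℝ × ℝ)} (hK : IsCompact K) (hP : IsCompact P)
    {γ : ℝ → ℝ × ℝ} (hγ : ContinuousOn γ (Set.Icc 0 1)) (hγg : γ '' Set.Ioo 0 1 ⊆ g)
    (hg : IsOpen g) (hgc : IsPreconnected g)
    (hfr : frontier g ⊆ K ∪ P) (hfrP : ¬ frontier g ⊆ P) :
    ∃ L : Set (ℝ × ℝ), IsCompact L ∧ IsPreconnected L ∧ γ 0 ∈ L ∧ (L ∩ K).Nonempty ∧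
      L ⊆ insert (γ 0) (g ∪ K \ P) := by
  obtain ⟨z, hz, hzP⟩ := Set.not_subset.1 hfrP
  obtain ⟨ε, hε, hεP⟩ := Metric.isOpen_iff.1 hP.isClosed.isOpen_compl z hzP
  obtain ⟨q', hq'g, hq'z⟩ := Metric.mem_closure_iff.1 (frontier_subset_closure hz) ε hε
  have hq : γ (1 / 2) ∈ g := hγg ⟨1 / 2, by norm_num, rfl⟩
  obtain ⟨w, hw⟩ := (hg.isConnected_iff_isPathConnected.1 ⟨⟨_, hq⟩, hgc⟩).joinedIn _ hq _ hq'g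
  let σ : ℝ → ℝ × ℝ := AffineMap.lineMap q' z
  have hσ : Continuous σ := AffineMap.lineMap_continuous
  have hσ0 : σ 0 = q' := AffineMap.lineMap_apply_zero _ _
  have hσ1 : σ 1 = z := AffineMap.lineMap_apply_one _ _
  have hσP : ∀ t ∈ Set.Icc (0 : ℝ) 1, σ t ∉ P := by
    intro t ht
    refine hεP ?_
    exact (convex_ball z ε).lineMap_mem (by rwa [Metric.mem_ball, _root_.dist_comm])
      (Metric.mem_ball_self hε) ht
  obtain ⟨t₀, ⟨ht₀, ht₀K⟩, hmin⟩ := (isCompact_Icc.inter_right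
    ((hK.union hP).isClosed.preimage hσ)).exists_isLeast
    (⟨1, by norm_num, by simpa [hσ1] using hfr hz⟩ :
      (Set.Icc (0 : ℝ) 1 ∩ σ ⁻¹' (K ∪ P)).Nonempty)
  have hσg : σ '' Set.Ico 0 t₀ ⊆ g := by
    rcases ht₀.1.eq_or_lt with h0 | h0
    · simp [← h0]
    · refine subset_of_disjoint_frontier (isPreconnected_Ico.image _ hσ.continuousOn) hg
        ⟨q', ⟨0, ⟨le_rfl, h0⟩, hσ0⟩, hq'g⟩ ?_
      rw [Set.disjoint_left]
      rintro _ ⟨t, ht, rfl⟩ hfrt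
      exact (hmin ⟨⟨ht.1, ht.2.le.trans ht₀.2⟩, hfr hfrt⟩).not_gt ht.2
  have hsub : Set.Icc (0 : ℝ) (1 / 2) ⊆ Set.Icc 0 1 := Set.Icc_subset_Icc_right (by norm_num)
  refine ⟨γ '' Set.Icc 0 (1 / 2) ∪ Set.range w ∪ σ '' Set.Icc 0 t₀, ?_, ?_, ?_, ?_, ?_⟩
  · exact ((isCompact_Icc.image_of_continuousOn (hγ.mono hsub)).union
      (isCompact_range w.continuous)).union (isCompact_Icc.image hσ)
  · refine IsPreconnected.union q' (Or.inr ⟨1, w.target⟩) ⟨0, ⟨le_rfl, ht₀.1⟩, hσ0⟩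
      (IsPreconnected.union (γ (1 / 2)) ⟨1 / 2, by norm_num, rfl⟩ ⟨0, w.source⟩ ?_ ?_) ?_
    · exact isPreconnected_Icc.image _ (hγ.mono hsub)
    · exact isPreconnected_range w.continuous
    · exact isPreconnected_Icc.image _ hσ.continuousOn
  · exact Or.inl (Or.inl ⟨0, by norm_num, rfl⟩)
  · exact ⟨σ t₀, Or.inr ⟨t₀, ⟨ht₀.1, le_rfl⟩, rfl⟩, ht₀K.resolve_right (hσP _ ht₀)⟩
  · rintro _ ((⟨t, ht, rfl⟩ | ⟨t, rfl⟩) | ⟨t, ht, rfl⟩)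
    · rcases ht.1.eq_or_lt with h0 | h0
      · exact Or.inl (by rw [h0])
      · exact Or.inr (Or.inl (hγg ⟨t, ⟨h0, by linarith [ht.2]⟩, rfl⟩))
    · exact Or.inr (Or.inl (hw t))
    · rcases ht.2.eq_or_lt with h0 | h0
      · subst h0
        exact Or.inr (Or.inr ⟨ht₀K.resolve_right (hσP _ ht₀), hσP _ ht₀⟩)
      · exact Or.inr (Or.inl (hσg ⟨t, ⟨ht.1, h0⟩, rfl⟩))

lemma arcImage_isCompact {γ : ℝ → ℝ × ℝ} (hγ : ContinuousOn γ (Set.Icc 0 1)) :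
    IsCompact (ArcImage γ) := isCompact_Icc.image_of_continuousOn hγ

/-- Two distinct faces of a theta-like plane set that are both bounded by the two arcs
`γl`, `γr` at `c` leave no room for a third arc at `c`. -/
lemma no_third_arc_at_corner {K f₁ f₂ : Set (ℝ × ℝ)} {γl γr γ : ℝ → ℝ × ℝ}
    (hK : IsCompact K) (hKc : IsPreconnected K)
    (hl : ContinuousOn γl (Set.Icc 0 1)) (hr : ContinuousOn γr (Set.Icc 0 1))
    (hγ : ContinuousOn γ (Set.Icc 0 1))
    (hli : Set.InjOn γl (Set.Icc 0 1)) (hri : Set.InjOn γr (Set.Icc 0 1))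
    (hlr : ArcImage γl ∩ ArcImage γr = {γ 0})
    (hlK : Disjoint (γl '' Set.Ioo 0 1) K) (hrK : Disjoint (γr '' Set.Ioo 0 1) K)
    (hl0 : γl 0 = γ 0) (hr0 : γr 0 = γ 0)
    (hγK : Disjoint (γ '' Set.Ioo 0 1) (K ∪ (ArcImage γl ∪ ArcImage γr)))
    (ho1 : IsOpen f₁) (ho2 : IsOpen f₂) (hc1 : IsPreconnected f₁) (hc2 : IsPreconnected f₂)
    (hn1 : f₁.Nonempty) (hn2 : f₂.Nonempty) (hne : f₁ ≠ f₂)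
    (hd1 : Disjoint f₁ (K ∪ (ArcImage γl ∪ ArcImage γr)))
    (hd2 : Disjoint f₂ (K ∪ (ArcImage γl ∪ ArcImage γr)))
    (hfr1 : frontier f₁ ⊆ K ∪ (ArcImage γl ∪ ArcImage γr))
    (hfr2 : frontier f₂ ⊆ K ∪ (ArcImage γl ∪ ArcImage γr))
    (hP1 : ArcImage γl ∪ ArcImage γr ⊆ frontier f₁)
    (hP2 : ArcImage γl ∪ ArcImage γr ⊆ frontier f₂)
    (hγ1 : Disjoint (γ '' Set.Ioo 0 1) f₁) (hγ2 : Disjoint (γ '' Set.Ioo 0 1) f₂) : False := by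
  have hlc := arcImage_isCompact hl
  have hrc := arcImage_isCompact hr
  obtain ⟨p₁, hp1⟩ := hn1
  obtain ⟨p₂, hp2⟩ := hn2
  set P := ArcImage γl ∪ ArcImage γr with hP
  have hPc : IsCompact P := hlc.union hrc
  have hint : Disjoint f₁ f₂ := by
    rw [Set.disjoint_iff_inter_eq_empty]
    by_contra h
    have h := Set.nonempty_iff_ne_empty.2 h
    refine hne (Set.Subset.antisymm ?_ ?_)
    · exact subset_of_disjoint_frontier hc1 ho2 h (hd1.mono_right hfr2)
    · exact subset_of_disjoint_frontier hc2 ho1 (by rwa [Set.inter_comm]) (hd2.mono_right hfr1)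
  have hsep : ¬ Unseparated (K ∪ P) p₁ p₂ := by
    rintro ⟨T, hT, hTK, hp, hq⟩
    exact hint.le_bot ⟨subset_of_disjoint_frontier hT ho1 ⟨p₁, hp, hp1⟩
      (hTK.mono_right hfr1) hq, hp2⟩
  have hq : γ (1 / 2) ∈ γ '' Set.Ioo 0 1 := ⟨1 / 2, by norm_num, rfl⟩
  have hcl : IsClosed (K ∪ P) := (hK.union hPc).isClosed
  set g := connectedComponentIn (K ∪ P)ᶜ (γ (1 / 2)) with hgdef
  have hgo : IsOpen g := hcl.isOpen_compl.connectedComponentIn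
  have hgc : IsPreconnected g := isPreconnected_connectedComponentIn
  have hgd : Disjoint g (K ∪ P) := Set.disjoint_left.2 (connectedComponentIn_subset _ _)
  have hgfr : frontier g ⊆ K ∪ P := frontier_connectedComponentIn_compl_subset hcl _
  have hγg : γ '' Set.Ioo 0 1 ⊆ g :=
    (isPreconnected_Ioo.image _ (hγ.mono Set.Ioo_subset_Icc_self)).subset_connectedComponentIn hq
      (Set.disjoint_left.1 hγK)
  have hgf : ∀ f : Set (ℝ × ℝ), IsOpen f → frontier f ⊆ K ∪ P →
      Disjoint (γ '' Set.Ioo 0 1) f → Disjoint g f := by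
    intro f hf hfrf hγf
    rw [Set.disjoint_iff_inter_eq_empty]
    by_contra h
    exact hγf.le_bot ⟨hq, subset_of_disjoint_frontier hgc hf (Set.nonempty_iff_ne_empty.2 h)
      (hgd.mono_right hfrf) (hγg hq)⟩
  have hg1 := hgf f₁ ho1 hfr1 hγ1
  have hg2 := hgf f₂ ho2 hfr2 hγ2
  have hfrP : ¬ frontier g ⊆ P := by
    intro hsub
    have hqP : γ (1 / 2) ∉ P := fun h => hγK.le_bot ⟨hq, Or.inr h⟩
    have hpP : p₁ ∉ P := fun h => hd1.le_bot ⟨hp1, Or.inr h⟩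
    obtain ⟨T, hT, hTP, hqT, hpT⟩ := janiszewski hlc hrc (by rw [hlr]; exact isPreconnected_singleton)
      (arc_unseparated hl hli (fun h => hqP (Or.inl h)) (fun h => hpP (Or.inl h)))
      (arc_unseparated hr hri (fun h => hqP (Or.inr h)) (fun h => hpP (Or.inr h)))
    exact hg1.le_bot ⟨subset_of_disjoint_frontier hT hgo ⟨_, hqT, hγg hq⟩
      (hTP.mono_right hsub) hpT, hp1⟩
  obtain ⟨L, hLc, hLp, hcL, ⟨k, hkL, hkK⟩, hLsub⟩ :=
    exists_connection hK hPc hγ hγg hgo hgc hgfr hfrP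
  have hc0 : γ 0 ∈ P := Or.inl (hlr.ge rfl).1
  have hLf : ∀ f : Set (ℝ × ℝ), Disjoint f (K ∪ P) → Disjoint g f → Disjoint f (K ∪ L) := by
    intro f hf hgf
    rw [Set.disjoint_left]
    rintro w hw (hwK | hwL)
    · exact hf.le_bot ⟨hw, Or.inl hwK⟩
    · rcases hLsub hwL with rfl | hwg | hwK
      · exact hf.le_bot ⟨hw, Or.inr hc0⟩
      · exact hgf.le_bot ⟨hwg, hw⟩
      · exact hf.le_bot ⟨hw, Or.inl hwK.1⟩
  have hM : IsPreconnected (K ∪ L) := IsPreconnected.union k hkK hkL hKc hLp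
  have mid : ∀ α β : ℝ → ℝ × ℝ, Set.InjOn α (Set.Icc 0 1) → α 0 = γ 0 →
      ArcImage α ∩ ArcImage β = {γ 0} → Disjoint (α '' Set.Ioo 0 1) K → ArcImage α ⊆ P →
      ArcImage β ⊆ P → Unseparated (K ∪ L ∪ ArcImage β) p₁ p₂ := by
    intro α β hα hα0 hαβ hαK hαP hβP
    have hv : α (1 / 2) ∈ ArcImage α := ⟨1 / 2, by norm_num, rfl⟩
    have hv0 : α (1 / 2) ≠ γ 0 := by
      rw [← hα0]
      intro h
      have := hα (by norm_num) (by norm_num) h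
      norm_num at this
    refine ⟨_, isPreconnected_union_insert hc1 hc2 (hP1 (hαP hv)) (hP2 (hαP hv)), ?_,
      Or.inl (Or.inr hp1), Or.inr (Or.inr hp2)⟩
    have hvd : α (1 / 2) ∉ K ∪ L ∪ ArcImage β := by
      rintro ((h | h) | h)
      · exact hαK.le_bot ⟨⟨1 / 2, by norm_num, rfl⟩, h⟩
      · rcases hLsub h with h | h | h
        · exact hv0 h
        · exact hgd.le_bot ⟨h, Or.inr (hαP hv)⟩
        · exact h.2 (hαP hv)
      · exact hv0 (hαβ.le ⟨hv, h⟩)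
    rw [Set.disjoint_left]
    rintro w ((rfl | hw) | (rfl | hw)) hwK
    · exact hvd hwK
    · exact hwK.elim (fun h => (hLf f₁ hd1 hg1).le_bot ⟨hw, h⟩)
        fun h => hd1.le_bot ⟨hw, Or.inr (hβP h)⟩
    · exact hvd hwK
    · exact hwK.elim (fun h => (hLf f₂ hd2 hg2).le_bot ⟨hw, h⟩)
        fun h => hd2.le_bot ⟨hw, Or.inr (hβP h)⟩
  have hs1 := mid γr γl hri hr0 (by rw [Set.inter_comm]; exact hlr) hrK
    Set.subset_union_right Set.subset_union_left
  have hs2 := mid γl γr hli hl0 hlr hlK Set.subset_union_left Set.subset_union_right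
  have hMc := hK.union hLc
  refine hsep ((janiszewski (hMc.union hlc) (hMc.union hrc) ?_ hs1 hs2).mono ?_)
  · rw [← Set.union_inter_distrib_left, hlr, Set.union_eq_self_of_subset_right]
    · exact hM
    · rw [Set.singleton_subset_iff]
      exact Or.inr hcL
  · rintro w (h | h | h)
    · exact Or.inl (Or.inl (Or.inl h))
    · exact Or.inl (Or.inr h)
    · exact Or.inr (Or.inr h)

section Drawing

variable {G : SimpleGraph V} {vtx : V → ℝ × ℝ} {arc : V → V → ℝ → ℝ × ℝ}

lemma IsPlaneEmbedding.arcImage_comm (h : IsPlaneEmbedding G vtx arc) {u v : V}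
    (huv : G.Adj u v) : ArcImage (arc v u) = ArcImage (arc u v) := by
  ext z
  constructor <;> rintro ⟨t, ht, rfl⟩ <;>
    refine ⟨1 - t, ⟨by linarith [ht.2], by linarith [ht.1]⟩, ?_⟩
  · rw [h.arc_symm huv]
  · rw [h.arc_symm huv]
    simp

lemma IsPlaneEmbedding.mem_arcImage (h : IsPlaneEmbedding G vtx arc) {u v : V}
    (huv : G.Adj u v) {z : ℝ × ℝ} (hz : z ∈ ArcImage (arc u v)) :
    z ∈ ArcInterior (arc u v) ∨ z = vtx u ∨ z = vtx v := by
  obtain ⟨t, ht, rfl⟩ := hz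
  rcases ht.1.eq_or_lt with h0 | h0
  · exact Or.inr (Or.inl (by rw [← h0, h.arc_start huv]))
  rcases ht.2.eq_or_lt with h1 | h1
  · exact Or.inr (Or.inr (by rw [h1, h.arc_end huv]))
  · exact Or.inl ⟨t, ⟨h0, h1⟩, rfl⟩

lemma IsPlaneEmbedding.left_mem_arcImage (h : IsPlaneEmbedding G vtx arc) {u v : V}
    (huv : G.Adj u v) : vtx u ∈ ArcImage (arc u v) :=
  ⟨0, by norm_num, h.arc_start huv⟩

lemma IsPlaneEmbedding.right_mem_arcImage (h : IsPlaneEmbedding G vtx arc) {u v : V}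
    (huv : G.Adj u v) : vtx v ∈ ArcImage (arc u v) :=
  ⟨1, by norm_num, h.arc_end huv⟩

lemma IsPlaneEmbedding.notMem_arcImage (h : IsPlaneEmbedding G vtx arc) {u v u' v' : V}
    (huv : G.Adj u v) (huv' : G.Adj u' v') (hne : s(u, v) ≠ s(u', v')) {z : ℝ × ℝ}
    (hz : z ∈ ArcInterior (arc u v)) : z ∉ ArcImage (arc u' v') := by
  intro hz'
  rcases h.mem_arcImage huv' hz' with h1 | rfl | rfl
  · exact (h.arc_disjoint huv huv' hne).le ⟨hz, h1⟩
  · exact h.arc_avoids_vtx huv _ hz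
  · exact h.arc_avoids_vtx huv _ hz

lemma mem_walkDrawing {a b : V} {w : G.Walk a b} {z : ℝ × ℝ} :
    z ∈ WalkDrawing G arc w ↔
      ∃ u v, G.Adj u v ∧ s(u, v) ∈ w.edges ∧ z ∈ ArcImage (arc u v) := by
  simp only [WalkDrawing, Set.mem_iUnion, exists_prop]

lemma IsPlaneEmbedding.walkDrawing_cons (h : IsPlaneEmbedding G vtx arc) {u v w : V}
    (huv : G.Adj u v) (p : G.Walk v w) :
    WalkDrawing G arc (Walk.cons huv p) = ArcImage (arc u v) ∪ WalkDrawing G arc p := by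
  ext z
  simp only [mem_walkDrawing, Set.mem_union, Walk.edges_cons, List.mem_cons]
  constructor
  · rintro ⟨x, y, hxy, he | he, hz⟩
    · left
      rcases Sym2.eq_iff.1 he with ⟨rfl, rfl⟩ | ⟨rfl, rfl⟩
      · exact hz
      · rwa [← h.arcImage_comm huv]
    · exact Or.inr ⟨x, y, hxy, he, hz⟩
  · rintro (hz | ⟨x, y, hxy, he, hz⟩)
    · exact ⟨u, v, huv, Or.inl rfl, hz⟩
    · exact ⟨x, y, hxy, Or.inr he, hz⟩

lemma IsPlaneEmbedding.isCompact_walkDrawing (h : IsPlaneEmbedding G vtx arc) {a b : V}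
    (p : G.Walk a b) : IsCompact (WalkDrawing G arc p) := by
  induction p with
  | nil => simp [WalkDrawing]
  | cons huv p ih =>
    rw [h.walkDrawing_cons]
    exact (arcImage_isCompact (h.arc_cont huv)).union ih

lemma IsPlaneEmbedding.isPreconnected_walkDrawing (h : IsPlaneEmbedding G vtx arc) {a b : V}
    (p : G.Walk a b) : IsPreconnected (insert (vtx a) (WalkDrawing G arc p)) := by
  induction p with
  | nil => simp [WalkDrawing, isPreconnected_singleton]
  | @cons u v w huv p ih =>
    have : insert (vtx u) (WalkDrawing G arc (Walk.cons huv p)) =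
        ArcImage (arc u v) ∪ insert (vtx v) (WalkDrawing G arc p) := by
      rw [h.walkDrawing_cons, Set.union_insert, Set.insert_eq_of_mem,
        Set.insert_eq_of_mem]
      · exact Or.inl (h.right_mem_arcImage huv)
      · exact Or.inl (h.left_mem_arcImage huv)
    rw [this]
    exact IsPreconnected.union _ (h.right_mem_arcImage huv) (Set.mem_insert _ _)
      (isPreconnected_Icc.image _ (h.arc_cont huv)) ih

lemma IsPlaneEmbedding.isClosed_drawing [Finite V] (h : IsPlaneEmbedding G vtx arc) :
    IsClosed (Drawing G vtx arc) := by
  refine (Set.finite_range vtx).isClosed.union ?_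
  exact isClosed_iUnion_of_finite fun u => isClosed_iUnion_of_finite fun v =>
    isClosed_iUnion_of_finite fun huv => (arcImage_isCompact (h.arc_cont huv)).isClosed

lemma arcImage_subset_drawing {u v : V} (huv : G.Adj u v) :
    ArcImage (arc u v) ⊆ Drawing G vtx arc := fun _ hz =>
  Or.inr (Set.mem_iUnion.2 ⟨u, Set.mem_iUnion.2 ⟨v, Set.mem_iUnion.2 ⟨huv, hz⟩⟩⟩)

lemma IsFace.disjoint_drawing {f : Set (ℝ × ℝ)} (hf : IsFace G vtx arc f) :
    Disjoint f (Drawing G vtx arc) := by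
  obtain ⟨p, -, rfl⟩ := hf
  exact Set.disjoint_left.2 (connectedComponentIn_subset _ _)

lemma IsFace.nonempty {f : Set (ℝ × ℝ)} (hf : IsFace G vtx arc f) : f.Nonempty := by
  obtain ⟨p, hp, rfl⟩ := hf
  exact ⟨p, mem_connectedComponentIn hp⟩

lemma IsFace.isPreconnected {f : Set (ℝ × ℝ)} (hf : IsFace G vtx arc f) : IsPreconnected f := by
  obtain ⟨p, -, rfl⟩ := hf
  exact isPreconnected_connectedComponentIn

lemma IsFace.isOpen [Finite V] (h : IsPlaneEmbedding G vtx arc) {f : Set (ℝ × ℝ)}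
    (hf : IsFace G vtx arc f) : IsOpen f := by
  obtain ⟨p, -, rfl⟩ := hf
  exact h.isClosed_drawing.isOpen_compl.connectedComponentIn

/-- If two distinct faces are both bounded by cycles through the corner `u c w`, then `c` has
no neighbor besides `u` and `w`. -/
lemma eq_or_eq_of_common_corner [Finite V] (h : IsPlaneEmbedding G vtx arc) {c u w d : V}
    (hu : G.Adj c u) (hw : G.Adj c w) (hd : G.Adj c d) (huw : u ≠ w)
    {q₁ q₂ : G.Walk u w} (hc1 : c ∉ q₁.support) (hc2 : c ∉ q₂.support) {a b : V}
    {w₁ : G.Walk a a} {w₂ : G.Walk b b} {f₁ f₂ : Set (ℝ × ℝ)}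
    (hf1 : FaceBoundedBy G vtx arc f₁ w₁) (hf2 : FaceBoundedBy G vtx arc f₂ w₂)
    (hne : f₁ ≠ f₂)
    (he1 : ∀ e, e ∈ w₁.edges ↔ e = s(c, u) ∨ e = s(c, w) ∨ e ∈ q₁.edges)
    (he2 : ∀ e, e ∈ w₂.edges ↔ e = s(c, u) ∨ e = s(c, w) ∨ e ∈ q₂.edges) :
    d = u ∨ d = w := by
  by_contra! hdd
  have hcov : ∀ {a : V} (p : G.Walk a a) (q : G.Walk u w),
      (∀ e, e ∈ p.edges ↔ e = s(c, u) ∨ e = s(c, w) ∨ e ∈ q.edges) →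
      WalkDrawing G arc p =
        WalkDrawing G arc q ∪ (ArcImage (arc c u) ∪ ArcImage (arc c w)) := by
    intro a p q he
    ext z
    simp only [mem_walkDrawing, Set.mem_union]
    constructor
    · rintro ⟨x, y, hxy, hexy, hz⟩
      rcases (he _).1 hexy with h' | h' | h'
      · rcases Sym2.eq_iff.1 h' with ⟨rfl, rfl⟩ | ⟨rfl, rfl⟩
        · exact Or.inr (Or.inl hz)
        · exact Or.inr (Or.inl (by rwa [← h.arcImage_comm hu]))
      · rcases Sym2.eq_iff.1 h' with ⟨rfl, rfl⟩ | ⟨rfl, rfl⟩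
        · exact Or.inr (Or.inr hz)
        · exact Or.inr (Or.inr (by rwa [← h.arcImage_comm hw]))
      · exact Or.inl ⟨x, y, hxy, h', hz⟩
    · rintro (⟨x, y, hxy, hexy, hz⟩ | hz | hz)
      · exact ⟨x, y, hxy, (he _).2 (Or.inr (Or.inr hexy)), hz⟩
      · exact ⟨c, u, hu, (he _).2 (Or.inl rfl), hz⟩
      · exact ⟨c, w, hw, (he _).2 (Or.inr (Or.inl rfl)), hz⟩
  have hcov1 := hf1.2.trans (hcov w₁ q₁ he1)
  have hcov2 := hf2.2.trans (hcov w₂ q₂ he2)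
  set K := insert (vtx u) (WalkDrawing G arc q₁) ∪ insert (vtx u) (WalkDrawing G arc q₂) with hK
  have hint : ∀ {v : V}, G.Adj c v → ∀ z ∈ ArcInterior (arc c v), z ∉ K := by
    intro v hv z hz
    have hq : ∀ q : G.Walk u w, c ∉ q.support → z ∉ insert (vtx u) (WalkDrawing G arc q) := by
      rintro q hcq (rfl | hzq)
      · exact h.arc_avoids_vtx hv _ hz
      · obtain ⟨x, y, hxy, hexy, hz'⟩ := mem_walkDrawing.1 hzq
        refine h.notMem_arcImage hv hxy ?_ hz hz'
        intro heq
        exact hcq (Walk.fst_mem_support_of_mem_edges q (heq ▸ hexy))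
    rintro (hz' | hz')
    exacts [hq _ hc1 hz', hq _ hc2 hz']
  have hWK1 : WalkDrawing G arc q₁ ⊆ K := (Set.subset_insert _ _).trans Set.subset_union_left
  have hWK2 : WalkDrawing G arc q₂ ⊆ K := (Set.subset_insert _ _).trans Set.subset_union_right
  have hdraw : K ∪ (ArcImage (arc c u) ∪ ArcImage (arc c w)) ⊆ Drawing G vtx arc := by
    have hq : ∀ q : G.Walk u w, insert (vtx u) (WalkDrawing G arc q) ⊆ Drawing G vtx arc := by
      rintro q z (rfl | hz)
      · exact Or.inl ⟨_, rfl⟩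
      · obtain ⟨x, y, hxy, -, hz'⟩ := mem_walkDrawing.1 hz
        exact arcImage_subset_drawing hxy hz'
    exact Set.union_subset (Set.union_subset (hq _) (hq _))
      (Set.union_subset (arcImage_subset_drawing hu) (arcImage_subset_drawing hw))
  have hsym : ∀ {v v' : V}, v ≠ v' → s(c, v) ≠ s(c, v') := fun hvv h => hvv (Sym2.congr_right.1 h)
  have hstart := fun {v : V} (hv : G.Adj c v) => h.arc_start hv
  refine no_third_arc_at_corner (K := K) (γl := arc c u) (γr := arc c w) (γ := arc c d)
    ?_ ?_ (h.arc_cont hu) (h.arc_cont hw) (h.arc_cont hd) (h.arc_injOn hu) (h.arc_injOn hw)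
    ?_ (Set.disjoint_left.2 (hint hu)) (Set.disjoint_left.2 (hint hw))
    ((hstart hu).trans (hstart hd).symm) ((hstart hw).trans (hstart hd).symm) ?_
    (hf1.1.isOpen h) (hf2.1.isOpen h) hf1.1.isPreconnected hf2.1.isPreconnected
    hf1.1.nonempty hf2.1.nonempty hne (hf1.1.disjoint_drawing.mono_right hdraw)
    (hf2.1.disjoint_drawing.mono_right hdraw) (hcov1 ▸ Set.union_subset_union_left _ hWK1)
    (hcov2 ▸ Set.union_subset_union_left _ hWK2) (hcov1 ▸ Set.subset_union_right)
    (hcov2 ▸ Set.subset_union_right) ?_ ?_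
  · exact ((h.isCompact_walkDrawing q₁).insert _).union ((h.isCompact_walkDrawing q₂).insert _)
  · exact IsPreconnected.union _ (Set.mem_insert _ _) (Set.mem_insert _ _)
      (h.isPreconnected_walkDrawing q₁) (h.isPreconnected_walkDrawing q₂)
  · rw [hstart hd]
    refine Set.Subset.antisymm ?_ (Set.singleton_subset_iff.2
      ⟨h.left_mem_arcImage hu, h.left_mem_arcImage hw⟩)
    rintro z ⟨hzu, hzw⟩
    rcases h.mem_arcImage hu hzu with h1 | h1 | rfl
    · exact absurd hzw (h.notMem_arcImage hu hw (hsym huw) h1)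
    · exact h1
    · rcases h.mem_arcImage hw hzw with h1 | h1 | h1
      · exact absurd h1 (h.arc_avoids_vtx hw _)
      · exact h1
      · exact absurd (h.vtx_inj h1) huw
  · rw [Set.disjoint_left]
    rintro z hz (hz' | hz' | hz')
    · exact hint hd z hz hz'
    · exact h.notMem_arcImage hd hu (hsym hdd.1) hz hz'
    · exact h.notMem_arcImage hd hw (hsym hdd.2) hz hz'
  all_goals
    rw [disjoint_comm]
    refine Disjoint.mono_right (c := Drawing G vtx arc) ?_ ?_
    · exact (Set.image_mono Set.Ioo_subset_Icc_self).trans (arcImage_subset_drawing hd)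
  exacts [hf1.1.disjoint_drawing, hf2.1.disjoint_drawing]

end Drawing

section Minimality

lemma IsPlanarGraph.of_injective_hom {W : Type} {G : SimpleGraph V} {H : SimpleGraph W}
    (f : H →g G) (hf : Function.Injective f) (h : IsPlanarGraph G) : IsPlanarGraph H := by
  obtain ⟨vtx, arc, h⟩ := h
  refine ⟨vtx ∘ f, fun u v => arc (f u) (f v), h.vtx_inj.comp hf,
    fun u v huv => h.arc_cont (f.map_adj huv), fun u v huv => h.arc_injOn (f.map_adj huv),
    fun u v huv => h.arc_start (f.map_adj huv), fun u v huv => h.arc_end (f.map_adj huv),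
    fun u v huv => h.arc_symm (f.map_adj huv),
    fun u v huv w => h.arc_avoids_vtx (f.map_adj huv) (f w),
    fun u v u' v' huv huv' hne => h.arc_disjoint (f.map_adj huv) (f.map_adj huv') ?_⟩
  exact fun heq => hne (Sym2.map.injective hf heq)

lemma Cycles5Apart.of_injective_hom {W : Type} {G : SimpleGraph V} {H : SimpleGraph W}
    (f : H →g G) (hf : Function.Injective f)
    (hr : ∀ x y, G.Reachable (f x) (f y) → H.Reachable x y) (h : Cycles5Apart G) :
    Cycles5Apart H := by
  intro u v c1 c2 h1 h2 hl1 hl2 hne x hx y hy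
  have hd : 3 ≤ G.dist (f x) (f y) := by
    refine h (c1.map f) (c2.map f) ((Walk.isCycle_map_iff_of_injective hf).2 h1)
      ((Walk.isCycle_map_iff_of_injective hf).2 h2) (by simpa) (by simpa) ?_ _ ?_ _ ?_
    · intro heq
      refine hne (Set.ext fun e => ?_)
      have := Set.ext_iff.1 heq (e.map f)
      simpa only [Set.mem_ofPred_eq, Walk.edges_map,
        List.mem_map_of_injective (Sym2.map.injective hf)] using this
    · rw [Walk.support_map]
      exact List.mem_map_of_mem hx
    · rw [Walk.support_map]
      exact List.mem_map_of_mem hy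
  obtain ⟨p, hp⟩ := (hr x y (Reachable.of_dist_ne_zero (by omega))).exists_walk_length_eq_dist
  have := dist_le (p.map f)
  rw [Walk.length_map, hp] at this
  omega

lemma HasClaw.map_hom {W : Type} {G : SimpleGraph V} {H : SimpleGraph W}
    (f : H →g G) (hf : Function.Injective f) {v : V} {w : W} {C : G.Walk v v} {C' : H.Walk w w}
    (hC : ∀ x, f x ∈ C.support ↔ x ∈ C'.support) (h : HasClaw H C') : HasClaw G C := by
  obtain ⟨x, hx, a, b, c, ha, hb, hc, hab, hac, hbc, h1, h2, h3⟩ := h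
  exact ⟨f x, by rwa [hC], f a, f b, f c, by rwa [hC], by rwa [hC], by rwa [hC], hf.ne hab,
    hf.ne hac, hf.ne hbc, f.map_adj h1, f.map_adj h2, f.map_adj h3⟩

lemma HasTriclaw.map_hom {W : Type} {G : SimpleGraph V} {H : SimpleGraph W}
    (f : H →g G) (hf : Function.Injective f) {v : V} {w : W} {C : G.Walk v v} {C' : H.Walk w w}
    (hC : ∀ x, f x ∈ C.support ↔ x ∈ C'.support) (h : HasTriclaw H C') : HasTriclaw G C := by
  obtain ⟨x, y, z, hx, hy, hz, hxy, hyz, hxz, a, b, c, ha, hb, hc, hab, hac, hbc, h1, h2, h3⟩ := h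
  exact ⟨f x, f y, f z, by rwa [hC], by rwa [hC], by rwa [hC], f.map_adj hxy, f.map_adj hyz,
    f.map_adj hxz, f a, f b, f c, by rwa [hC], by rwa [hC], by rwa [hC], hf.ne hab,
    hf.ne hac, hf.ne hbc, f.map_adj h1, f.map_adj h2, f.map_adj h3⟩

lemma IFColoringOn.comp_hom {W : Type} {G : SimpleGraph V} {H : SimpleGraph W}
    (f : H →g G) (hf : Function.Injective f) {S : Set V} {c : V → Bool}
    (h : IFColoringOn G S c) : IFColoringOn H (f ⁻¹' S) (c ∘ f) := by
  refine ⟨fun u v hu hv huv => h.1 hu hv (f.map_adj huv), fun v w hw hS hF => ?_⟩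
  refine h.2 _ (w.map f) ((Walk.isCycle_map_iff_of_injective hf).2 hw) ?_ ?_ <;>
  · intro x hx
    rw [Walk.support_map, List.mem_map] at hx
    obtain ⟨y, hy, rfl⟩ := hx
    first | exact hS y hy | exact hF y hy

lemma SuperIFColoring.comp_iso {W : Type} {G : SimpleGraph V} {H : SimpleGraph W}
    (f : H ≃g G) {Q : Set V} {c : V → Bool} (h : SuperIFColoring G Q c) :
    SuperIFColoring H (f ⁻¹' Q) (c ∘ f) := by
  refine ⟨⟨fun u v huv => h.1.1 (f.map_adj_iff.2 huv), fun v w hw hF => ?_⟩, ?_⟩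
  · refine h.1.2 _ (w.map f.toHom) ((Walk.isCycle_map_iff_of_injective f.injective).2 hw) ?_
    intro x hx
    rw [Walk.support_map, List.mem_map] at hx
    obtain ⟨y, hy, rfl⟩ := hx
    exact hF y hy
  · rintro a b p ⟨hp, hF, ha, hb, hl, hQ⟩
    refine h.2 _ _ (p.map f.toHom)
      ⟨(Walk.isPath_map_iff_of_injective f.injective).2 hp, ?_, ha, hb, by simpa, ?_⟩
    all_goals
      intro x hx
      rw [Walk.support_map, List.mem_map] at hx
      obtain ⟨y, hy, rfl⟩ := hx
    · exact hF y hy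
    · exact fun hya hyb => hQ y hy (fun h => hya (h ▸ rfl)) (fun h => hyb (h ▸ rfl))

lemma reachable_deleteEdges_of_isCycle {G : SimpleGraph V} {e : Sym2 V} {u : V}
    {w : G.Walk u u} (hw : w.IsCycle) (he : e ∈ w.edges) {x y : V} (h : G.Reachable x y) :
    (G.deleteEdges {e}).Reachable x y := by
  obtain ⟨p⟩ := h
  induction p with
  | nil => exact Reachable.refl _
  | @cons x z y hxz p ih =>
    refine Reachable.trans ?_ ih
    by_cases hxe : s(x, z) = e
    · subst hxe
      by_contra hb
      exact IsBridge.notMem_edges_of_isCycle (isBridge_iff.2 hb) hw he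
    · exact Adj.reachable (deleteEdges_adj.2 ⟨hxz, hxe⟩)

/-- Deleting an edge that lies on a cycle but not on `C0` from a minimal counterexample leaves
a graph to which the precoloring extends. -/
lemma IsMinimalCounterexample.exists_super_deleteEdges [Fintype V] {G : SimpleGraph V} {v0 : V}
    {C0 : G.Walk v0 v0} {c0 : V → Bool} (hmin : IsMinimalCounterexample G C0 c0) {e : Sym2 V}
    {u : V} {w : G.Walk u u} (hw : w.IsCycle) (he : e ∈ w.edges) (heC : e ∉ C0.edges) :
    ∃ c : V → Bool, SuperIFColoring (G.deleteEdges {e}) {x | x ∈ C0.support} c ∧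
      ∀ x ∈ C0.support, c x = c0 x := by
  by_contra hcon
  obtain ⟨⟨hpl, hcyc, ⟨hC, hgood⟩, hlen, hcol, -⟩, hleast⟩ := hmin
  let f : Fin (Fintype.card V) ≃ V := (Fintype.equivFin V).symm
  let H := (G.deleteEdges {e}).comap f
  let ψ : H ≃g G.deleteEdges {e} := Iso.comap f _
  let g : H →g G := (Hom.ofLE (deleteEdges_le _)).comp ψ.toHom
  have hgf : ⇑g = f := rfl
  have hg : Function.Injective g := f.injective
  have heC' : ∀ e' ∈ C0.edges, e' ∉ ({e} : Set (Sym2 V)) := by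
    rintro e' h' rfl
    exact heC h'
  let C := (C0.toDeleteEdges {e} heC').map ψ.symm.toHom
  have hsupp : ∀ x, g x ∈ C0.support ↔ x ∈ C.support := by
    intro x
    have : C.support = C0.support.map f.symm := by
      simp only [C, Walk.support_map]
      congr 1
      simp [Walk.toDeleteEdges]
    rw [this, hgf, List.mem_map]
    constructor
    · exact fun h => ⟨_, h, by simp⟩
    · rintro ⟨y, hy, rfl⟩
      simpa using hy
  have hClen : C.length = C0.length := by simp [C, Walk.toDeleteEdges]
  have hCC : C.IsCycle :=
    (Walk.isCycle_map_iff_of_injective ψ.symm.injective).2 (Walk.IsCycle.toDeleteEdges G {e} hC heC')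
  have hset : {x | x ∈ C.support} = g ⁻¹' {x | x ∈ C0.support} := by
    ext x
    exact (hsupp x).symm
  have hsize := hleast _ H _ C (c0 ∘ g) ⟨hpl.of_injective_hom g hg, ?_, ⟨hCC, ?_⟩, ?_, ?_, ?_⟩
  · have h1 : H.edgeSet.ncard = (G.deleteEdges {e}).edgeSet.ncard :=
      Nat.card_congr ψ.mapEdgeSet
    have h2 : (G.deleteEdges {e}).edgeSet.ncard < G.edgeSet.ncard := by
      rw [edgeSet_deleteEdges]
      exact Set.ncard_sdiff_singleton_lt_of_mem (Walk.edges_subset_edgeSet _ he)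
        (Set.toFinite _)
    simp only [graphSize, Fintype.card_fin] at hsize
    omega
  · refine hcyc.of_injective_hom g hg fun x y h => ?_
    exact (Iso.reachable_iff (φ := ψ)).1 (reachable_deleteEdges_of_isCycle hw he h)
  · rintro ⟨-, h9, hbad⟩
    refine hgood ⟨hC, hClen ▸ h9, hbad.imp ?_ ?_⟩
    · exact fun h => h.map_hom g hg hsupp
    · exact fun h => h.map_hom g hg hsupp
  · rwa [hClen]
  · rw [hset]
    exact hcol.comp_hom g hg
  · rintro ⟨c, hc, hcc⟩
    refine hcon ⟨c ∘ f.symm, ?_, fun x hx => ?_⟩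
    · have := hc.comp_iso ψ.symm
      convert this using 1
      · ext x
        rw [hset]
        change _ ↔ f (f.symm x) ∈ C0.support
        simp
      · rfl
    · have := hcc (f.symm x) ((hsupp _).1 (by simpa [hgf] using hx))
      simpa [hgf] using this

end Minimality

section ThetaColoring

/-- Adjacency in the cycle `0, 1, …, 5 + k` with the chord joining `0` and `5`. -/
def chordedAdj (k i j : ℕ) : Bool :=
  j.beq (i + 1) || i.beq (j + 1) || (i.beq 0 && (j.beq 5 || j.beq (5 + k))) ||
    (j.beq 0 && (i.beq 5 || i.beq (5 + k)))

/-- Each entry of the list has at most one neighbor among the later entries, counting one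
additional neighbor for the entries marked by `tok`. -/
def buildsForest (adj : ℕ → ℕ → Bool) (tok : ℕ → Bool) : List ℕ → Bool
  | [] => true
  | i :: l => buildsForest adj tok l && ((l.filter (adj i)).length + (tok i).toNat).ble 1

/-- The list `l` describes the `F`-part of an admissible coloring of the chorded cycle: its
complement is independent and consists of `5` and of vertices marked by `tok`. -/
def admissible (k : ℕ) (tok : ℕ → Bool) (l : List ℕ) : Bool :=
  l.all (fun i => i.blt (6 + k)) && buildsForest (chordedAdj k) tok l &&
    (List.range (6 + k)).all fun i => l.contains i || ((tok i || i.beq 5) &&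
      (List.range (6 + k)).all fun j => !chordedAdj k i j || l.contains j)

/-- Order a set of vertices greedily for `buildsForest`. -/
def greedyOrder (adj : ℕ → ℕ → Bool) (tok : ℕ → Bool) : ℕ → List ℕ → List ℕ
  | 0, _ => []
  | m + 1, F =>
    match F.find? fun i => ((F.filter (adj i)).length + (tok i).toNat).ble 1 with
    | none => []
    | some i => i :: greedyOrder adj tok m (F.erase i)

/-- The vertices of the chorded cycle outside the bit mask `m`, ordered greedily with respect to the
marks in the bit mask `t`. -/
def complementOrder (k t m : ℕ) : List ℕ :=
  greedyOrder (chordedAdj k) t.testBit (6 + k)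
    ((List.range (6 + k)).filter fun i => !m.testBit i)

/-- Bit masks of the independent sets that suffice for all markings. -/
def independentMasks : ℕ → List ℕ
  | 1 => [34, 36, 40, 21, 42, 32, 17, 9, 5, 82, 1, 66, 80, 74, 84]
  | 2 => [164, 34, 168, 36, 21, 162, 40, 65, 42, 73, 32, 170, 160, 17, 69, 84, 80]
  | _ => [292, 162, 296, 164, 290, 42, 21, 168, 36, 149, 65, 170, 32, 298, 17, 288, 34, 40, 160,
      69, 145, 73, 137, 133, 84, 338, 129, 80, 322, 336, 330, 340]

set_option maxRecDepth 100000 in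
theorem exists_admissible_bits : ∀ k ∈ [1, 2, 3], ∀ t ∈ List.range (2 ^ (6 + k)),
    t.testBit 5 = false → ∃ m ∈ independentMasks k,
      ((m &&& (t ||| 32)).beq m && admissible k t.testBit (complementOrder k t m)) = true := by
  decide +kernel

end ThetaColoring

section Extension

/-- The set `A` spans no cycle of `G` and no path splitting `Q`. -/
def SplitFree (G : SimpleGraph V) (Q A : Set V) : Prop :=
  (∀ (v : V) (w : G.Walk v v), w.IsCycle → ¬ ∀ x ∈ w.support, x ∈ A) ∧
  ∀ (a b : V) (p : G.Walk a b), ¬ (p.IsPath ∧ (∀ x ∈ p.support, x ∈ A) ∧ a ∈ Q ∧ b ∈ Q ∧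
    2 ≤ p.length ∧ ∀ x ∈ p.support, x ≠ a → x ≠ b → x ∉ Q)

lemma superIFColoring_iff {G : SimpleGraph V} {Q : Set V} {c : V → Bool} :
    SuperIFColoring G Q c ↔
      (∀ ⦃u v : V⦄, G.Adj u v → c u = true → c v = false) ∧ SplitFree G Q {x | c x = false} :=
  and_assoc

lemma SplitFree.mono {G : SimpleGraph V} {Q A B : Set V} (h : SplitFree G Q A) (hBA : B ⊆ A) :
    SplitFree G Q B :=
  ⟨fun v w hw hB => h.1 v w hw fun x hx => hBA (hB x hx),
    fun a b p hp => h.2 a b p ⟨hp.1, fun x hx => hBA (hp.2.1 x hx), hp.2.2⟩⟩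

lemma SplitFree.of_deleteEdges {G : SimpleGraph V} {Q A : Set V} {u v : V} (hu : u ∉ A)
    (h : SplitFree (G.deleteEdges {s(u, v)}) Q A) : SplitFree G Q A := by
  have key : ∀ {a b : V} (p : G.Walk a b), (∀ x ∈ p.support, x ∈ A) →
      ∀ e ∈ p.edges, e ∉ ({s(u, v)} : Set (Sym2 V)) := by
    rintro a b p hp e he rfl
    exact hu (hp u (p.fst_mem_support_of_mem_edges he))
  have hsupp : ∀ {a b : V} (p : G.Walk a b) (hp : ∀ e ∈ p.edges, e ∉ ({s(u, v)} : Set (Sym2 V))),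
      (p.toDeleteEdges _ hp).support = p.support := by
    intro a b p hp
    simp [Walk.toDeleteEdges]
  refine ⟨fun a w hw hA => h.1 a (w.toDeleteEdges _ (key w hA))
    (Walk.IsCycle.toDeleteEdges G _ hw _) (by rwa [hsupp]), ?_⟩
  rintro a b p ⟨hp, hA, ha, hb, hl, hQ⟩
  refine h.2 a b (p.toDeleteEdges _ (key p hA)) ⟨?_, by rwa [hsupp], ha, hb, ?_, by rwa [hsupp]⟩
  · rw [Walk.isPath_def, hsupp]
    exact (Walk.isPath_def _).1 hp
  · simpa [Walk.toDeleteEdges] using hl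

lemma exists_two_neighbors_of_isCycle {G : SimpleGraph V} {v : V} {w : G.Walk v v}
    (hw : w.IsCycle) : ∃ u u', u ≠ u' ∧ G.Adj v u ∧ G.Adj v u' ∧ u ∈ w.support ∧
      u' ∈ w.support :=
  ⟨w.snd, w.penultimate, hw.snd_ne_penultimate, w.adj_snd hw.not_nil,
    (w.adj_penultimate hw.not_nil).symm, w.getVert_mem_support _, w.getVert_mem_support _⟩

lemma exists_two_neighbors_of_isPath {G : SimpleGraph V} {a b v : V} {p : G.Walk a b}
    (hp : p.IsPath) (hv : v ∈ p.support) (hva : v ≠ a) (hvb : v ≠ b) :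
    ∃ u u', u ≠ u' ∧ G.Adj v u ∧ G.Adj v u' ∧ u ∈ p.support ∧ u' ∈ p.support := by
  obtain ⟨n, rfl, hn⟩ := Walk.mem_support_iff_exists_getVert.1 hv
  have h0 : n ≠ 0 := by
    rintro rfl
    exact hva p.getVert_zero
  have h1 : n ≠ p.length := by
    rintro rfl
    exact hvb p.getVert_length
  obtain ⟨m, rfl⟩ := Nat.exists_eq_succ_of_ne_zero h0
  refine ⟨p.getVert m, p.getVert (m + 2), fun h => ?_,
    (p.adj_getVert_succ (by omega)).symm, p.adj_getVert_succ (by omega),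
    p.getVert_mem_support _, p.getVert_mem_support _⟩
  have := hp.getVert_injOn (by simp; omega) (by simp; omega) h
  omega

lemma SplitFree.insert {G : SimpleGraph V} {Q A : Set V} (h : SplitFree G Q A) {v : V}
    (hvQ : v ∉ Q) (hv : ∀ u ∈ A, ∀ u' ∈ A, G.Adj v u → G.Adj v u' → u = u') :
    SplitFree G Q (insert v A) := by
  classical
  have key : ∀ {S : List V}, (∀ x ∈ S, x ∈ Insert.insert v A) → v ∈ S →
      (∃ u u', u ≠ u' ∧ G.Adj v u ∧ G.Adj v u' ∧ u ∈ S ∧ u' ∈ S) → False := by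
    rintro S hS - ⟨u, u', hne, hu, hu', huS, huS'⟩
    exact hne (hv u ((hS u huS).resolve_left hu.ne') u' ((hS u' huS').resolve_left hu'.ne') hu hu')
  refine ⟨fun a w hw hA => ?_, ?_⟩
  · by_cases hvw : v ∈ w.support
    · refine key hA hvw ?_
      obtain ⟨u, u', h1, h2, h3, h4, h5⟩ := exists_two_neighbors_of_isCycle (hw.rotate hvw)
      exact ⟨u, u', h1, h2, h3, (Walk.mem_support_rotate_iff _ _ hvw).1 h4,
        (Walk.mem_support_rotate_iff _ _ hvw).1 h5⟩
    · exact h.1 a w hw fun x hx => (hA x hx).resolve_left fun hxv => hvw (hxv ▸ hx)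
  · rintro a b p ⟨hp, hA, ha, hb, hl, hQ⟩
    by_cases hvp : v ∈ p.support
    · exact key hA hvp (exists_two_neighbors_of_isPath hp hvp (fun h => hvQ (h ▸ ha))
        fun h => hvQ (h ▸ hb))
    · exact h.2 a b p ⟨hp, fun x hx => (hA x hx).resolve_left fun hxv => hvp (hxv ▸ hx),
        ha, hb, hl, hQ⟩

lemma SplitFree.union_of_buildsForest {G : SimpleGraph V} {Q A : Set V} (h : SplitFree G Q A)
    {adj : ℕ → ℕ → Bool} {tok : ℕ → Bool} {s : ℕ → V} {n : ℕ}
    (hadj : ∀ i < n, ∀ j < n, G.Adj (s i) (s j) → adj i j = true) (hQ : ∀ i < n, s i ∉ Q)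
    (hout : ∀ i < n, ∀ u ∈ A, ∀ u' ∈ A, G.Adj (s i) u → G.Adj (s i) u' → u = u')
    (htok : ∀ i < n, ∀ u ∈ A, G.Adj (s i) u → tok i = true) :
    ∀ l : List ℕ, (∀ i ∈ l, i < n) → buildsForest adj tok l = true →
      SplitFree G Q (A ∪ {x | ∃ i ∈ l, s i = x})
  | [], _, _ => by simpa using h
  | i :: l, hl, hb => by
    simp only [buildsForest, Bool.and_eq_true, Nat.ble_eq] at hb
    have ih := SplitFree.union_of_buildsForest h hadj hQ hout htok l
      (fun j hj => hl j (List.mem_cons_of_mem _ hj)) hb.1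
    have hi : i < n := hl i List.mem_cons_self
    have hmem : ∀ j ∈ l, G.Adj (s i) (s j) → j ∈ l.filter (adj i) := fun j hj hij =>
      List.mem_filter.2 ⟨hj, hadj i hi j (hl j (List.mem_cons_of_mem _ hj)) hij⟩
    have hAl : ∀ u ∈ A, G.Adj (s i) u → ∀ j ∈ l, ¬ G.Adj (s i) (s j) := by
      intro u hu hiu j hj hij
      have h1 := htok i hi u hu hiu
      have h2 := List.length_pos_of_mem (hmem j hj hij)
      have h3 := hb.2
      rw [h1, Bool.toNat_true] at h3
      omega
    refine (ih.insert (hQ i hi) ?_).mono ?_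
    · rintro u (hu | ⟨j, hj, rfl⟩) u' (hu' | ⟨j', hj', rfl⟩) h1 h2
      · exact hout i hi u hu u' hu' h1 h2
      · exact absurd h2 (hAl u hu h1 j' hj')
      · exact absurd h1 (hAl u' hu' h2 j hj)
      · have h3 := hmem j hj h1
        have h4 := hmem j' hj' h2
        have hlen : (l.filter (adj i)).length ≤ 1 := by omega
        match hf : l.filter (adj i), hlen with
        | [], _ => simp [hf] at h3
        | [z], _ =>
          rw [hf, List.mem_singleton] at h3 h4
          rw [h3, h4]
    · rintro x (hx | ⟨j, hj, rfl⟩)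
      · exact Or.inr (Or.inl hx)
      · rcases List.mem_cons.1 hj with rfl | hj
        · exact Or.inl rfl
        · exact Or.inr (Or.inr ⟨j, hj, rfl⟩)

lemma exists_admissible {k : ℕ} (hk : k ∈ [1, 2, 3]) (free : ℕ → Prop) :
    ∃ (tok : ℕ → Bool) (l : List ℕ), (∀ i < 6 + k, tok i = true ↔ free i ∧ i ≠ 5) ∧
      admissible k tok l = true := by
  classical
  let t := Nat.ofBits fun i : Fin (6 + k) => decide (free i ∧ (i : ℕ) ≠ 5)
  have ht : ∀ i < 6 + k, t.testBit i = true ↔ free i ∧ i ≠ 5 := by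
    intro i hi
    rw [Nat.testBit_ofBits_lt _ _ hi]
    simp
  have h5 : t.testBit 5 = false := by
    rw [Bool.eq_false_iff]
    intro h
    exact ((ht 5 (by omega)).1 h).2 rfl
  obtain ⟨m, -, hm⟩ := exists_admissible_bits k hk t
    (List.mem_range.2 (Nat.ofBits_lt_two_pow _)) h5
  exact ⟨_, _, ht, (Bool.and_eq_true_iff.1 hm).2⟩

/-- If `G` induces a chorded cycle on `S`, then a super IF-coloring of `G` minus an edge inside `S`
can be recolored on `S` to a super IF-coloring of `G`. -/
lemma exists_superIFColoring_of_chorded {G : SimpleGraph V} {Q : Set V} {k : ℕ}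
    (hk : k ∈ [1, 2, 3]) {s : ℕ → V}
    (hadj : ∀ i < 6 + k, ∀ j < 6 + k, G.Adj (s i) (s j) → chordedAdj k i j = true)
    (hQ : ∀ i < 6 + k, s i ∉ Q) {S : Set V} (hS : ∀ x, x ∈ S ↔ ∃ i < 6 + k, s i = x)
    (hout : ∀ i < 6 + k, ∀ u ∉ S, ∀ u' ∉ S, G.Adj (s i) u → G.Adj (s i) u' → u = u')
    (h5 : ∀ u ∉ S, ¬ G.Adj (s 5) u) {u₀ v₀ : V} (hu₀ : u₀ ∈ S) (hv₀ : v₀ ∈ S) {c : V → Bool}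
    (hc : SuperIFColoring (G.deleteEdges {s(u₀, v₀)}) Q c) :
    ∃ c' : V → Bool, SuperIFColoring G Q c' ∧ ∀ x ∉ S, c' x = c x := by
  classical
  obtain ⟨tok, l, htok, hl⟩ := exists_admissible hk
    fun i => ¬ ∃ u ∉ S, G.Adj (s i) u ∧ c u = true
  simp only [admissible, Bool.and_eq_true, Bool.or_eq_true, List.all_eq_true, List.mem_range,
    Nat.blt_eq, List.contains_iff_mem, Nat.beq_eq, Bool.not_eq_true'] at hl
  obtain ⟨⟨hln, hb⟩, hI⟩ := hl
  obtain ⟨hc1, hc2⟩ := superIFColoring_iff.1 hc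
  have hsS : ∀ i < 6 + k, s i ∈ S := fun i hi => (hS _).2 ⟨i, hi, rfl⟩
  have hfree : ∀ i < 6 + k, i ∉ l → ∀ u ∉ S, G.Adj (s i) u → c u = false := by
    intro i hi hil u hu hiu
    rcases ((hI i hi).resolve_left hil).1 with h | rfl
    · by_contra hcu
      exact ((htok i hi).1 h).1 ⟨u, hu, hiu, by simpa using hcu⟩
    · exact absurd hiu (h5 u hu)
  refine ⟨fun x => if x ∈ S then decide (¬ ∃ i ∈ l, s i = x) else c x, ?_, fun x hx => by simp [hx]⟩
  refine superIFColoring_iff.2 ⟨fun u v huv hu => ?_, ?_⟩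
  · by_cases huS : u ∈ S <;> by_cases hvS : v ∈ S <;>
      simp only [huS, hvS, if_true, if_false, decide_eq_true_eq, decide_eq_false_iff_not,
        not_not] at hu ⊢
    · obtain ⟨i, hi, rfl⟩ := (hS u).1 huS
      obtain ⟨j, hj, rfl⟩ := (hS v).1 hvS
      have hil : i ∉ l := fun h => hu ⟨i, h, rfl⟩
      refine ⟨j, (((hI i hi).resolve_left hil).2 j hj).resolve_left ?_, rfl⟩
      rw [hadj i hi j hj huv]
      simp
    · obtain ⟨i, hi, rfl⟩ := (hS u).1 huS
      exact hfree i hi (fun h => hu ⟨i, h, rfl⟩) v hvS huv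
    · obtain ⟨j, hj, rfl⟩ := (hS v).1 hvS
      by_contra hjl
      have := hfree j hj (fun h => hjl ⟨j, h, rfl⟩) u huS huv.symm
      simp [hu] at this
    · refine hc1 (deleteEdges_adj.2 ⟨huv, fun h => ?_⟩) hu
      rcases Sym2.eq_iff.1 h with ⟨rfl, -⟩ | ⟨rfl, -⟩
      exacts [huS hu₀, huS hv₀]
  · have hA : SplitFree G Q {x | x ∉ S ∧ c x = false} :=
      SplitFree.of_deleteEdges (fun h => h.1 hu₀) (hc2.mono fun x hx => hx.2)
    refine (hA.union_of_buildsForest hadj hQ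
      (fun i hi u hu u' hu' => hout i hi u hu.1 u' hu'.1) (fun i hi u hu hiu => ?_)
      l hln hb).mono fun x hx => ?_
    · refine (htok i hi).2 ⟨?_, ?_⟩
      · rintro ⟨u', hu'S, hiu', hcu'⟩
        have := hu.2
        rw [hout i hi u hu.1 u' hu'S hiu hiu', hcu'] at this
        cases this
      · rintro rfl
        exact h5 u hu.1 hiu
    · by_cases hxS : x ∈ S
      · simp only [Set.mem_ofPred_eq, hxS, if_true, decide_eq_false_iff_not, not_not] at hx
        exact Or.inr hx
      · simp only [Set.mem_ofPred_eq, hxS, if_false] at hx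
        exact Or.inl ⟨hxS, hx⟩

end Extension

section ShortCycles

lemma exists_isPath_of_mem_edges_of_isCycle {G : SimpleGraph V} {u x y : V} {w : G.Walk u u}
    (hw : w.IsCycle) (he : s(x, y) ∈ w.edges) :
    ∃ p : G.Walk y x, p.IsPath ∧ p.length + 1 = w.length ∧ s(x, y) ∉ p.edges ∧
      (∀ e, e ∈ w.edges ↔ e = s(x, y) ∨ e ∈ p.edges) ∧ ∀ z, z ∈ w.support ↔ z ∈ p.support := by
  classical
  have key : ∀ c : G.Walk x x, c.IsCycle → c.snd = y →
      ∃ p : G.Walk y x, p.IsPath ∧ p.length + 1 = c.length ∧ s(x, y) ∉ p.edges ∧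
      (∀ e, e ∈ c.edges ↔ e = s(x, y) ∨ e ∈ p.edges) ∧ ∀ z, z ∈ c.support ↔ z ∈ p.support := by
    intro c hc hy
    cases c with
    | nil => exact absurd rfl hc.ne_nil
    | @cons _ v _ h p =>
      obtain rfl : v = y := by simpa using hy
      rw [Walk.cons_isCycle_iff] at hc
      refine ⟨p, hc.1, rfl, hc.2, by simp, fun z => ?_⟩
      simp only [Walk.support_cons, List.mem_cons]
      exact ⟨fun h => h.elim (fun h => h ▸ p.end_mem_support) id, Or.inr⟩
  have hx := Walk.fst_mem_support_of_mem_edges w he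
  have hc := hw.rotate hx
  have hmem : y = (w.rotate x hx).snd ∨ y = (w.rotate x hx).penultimate := by
    have : y ∈ (w.rotate x hx).toSubgraph.neighborSet x := by
      rw [Subgraph.mem_neighborSet, ← Subgraph.mem_edgeSet, Walk.mem_edges_toSubgraph]
      exact (Walk.rotate_edges w x hx).mem_iff.2 he
    rwa [hc.neighborSet_toSubgraph_endpoint] at this
  have hlen : (w.rotate x hx).length = w.length := by simp
  have hedge : ∀ e, e ∈ (w.rotate x hx).edges ↔ e ∈ w.edges :=
    fun e => (Walk.rotate_edges w x hx).mem_iff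
  have hsupp : ∀ z, z ∈ (w.rotate x hx).support ↔ z ∈ w.support :=
    fun z => Walk.mem_support_rotate_iff _ _ hx
  rcases hmem with hy | hy
  · obtain ⟨p, hp⟩ := key _ hc hy.symm
    simp only [hlen, hedge, hsupp] at hp
    exact ⟨p, hp⟩
  · obtain ⟨p, hp⟩ := key _ hc.reverse (by simpa using hy.symm)
    simp only [Walk.length_reverse, Walk.edges_reverse, Walk.support_reverse, List.mem_reverse,
      hlen, hedge, hsupp] at hp
    exact ⟨p, hp⟩

lemma eq_or_eq_of_snd_eq_snd [Finite V] {G : SimpleGraph V} {vtx : V → ℝ × ℝ}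
    {arc : V → V → ℝ → ℝ × ℝ} (h : IsPlaneEmbedding G vtx arc) {c w d : V}
    (hw : G.Adj c w) (hd : G.Adj c d) {p₁ p₂ : G.Walk c w} (hp₁ : p₁.IsPath) (hp₂ : p₂.IsPath)
    (hcw : s(c, w) ∉ p₁.edges) (hsnd : p₁.snd = p₂.snd) {a b : V} {w₁ : G.Walk a a}
    {w₂ : G.Walk b b} {f₁ f₂ : Set (ℝ × ℝ)} (hf1 : FaceBoundedBy G vtx arc f₁ w₁)
    (hf2 : FaceBoundedBy G vtx arc f₂ w₂) (hne : f₁ ≠ f₂)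
    (he1 : ∀ e, e ∈ w₁.edges ↔ e = s(c, w) ∨ e ∈ p₁.edges)
    (he2 : ∀ e, e ∈ w₂.edges ↔ e = s(c, w) ∨ e ∈ p₂.edges) : d = p₁.snd ∨ d = w := by
  cases p₁ with
  | nil => exact absurd rfl hw.ne
  | @cons _ u _ hu q₁ =>
    cases p₂ with
    | nil => exact absurd rfl hw.ne
    | @cons _ u' _ hu' q₂ =>
      simp only [Walk.snd_cons] at hsnd
      subst hsnd
      rw [Walk.cons_isPath_iff] at hp₁ hp₂
      simp only [Walk.snd_cons]
      refine eq_or_eq_of_common_corner h hu hw hd ?_ hp₁.2 hp₂.2 hf1 hf2 hne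
        (fun e => ?_) (fun e => ?_)
      · rintro rfl
        simp at hcw
      · rw [he1, Walk.edges_cons, List.mem_cons]
        tauto
      · rw [he2, Walk.edges_cons, List.mem_cons]
        tauto

variable {G : SimpleGraph V} {W : Set (Sym2 V)}

lemma mem_of_triangle {p q r : V}
    (h : ∀ w : G.Walk p p, w.IsCycle → w.length ≤ 5 → ∀ e ∈ w.edges, e ∈ W)
    (h1 : G.Adj p q) (h2 : G.Adj q r) (h3 : G.Adj r p) :
    s(p, q) ∈ W ∧ s(q, r) ∈ W ∧ s(r, p) ∈ W := by
  have := h (.cons h1 (.cons h2 (.cons h3 .nil)))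
    (by simp [Walk.cons_isCycle_iff, h1.ne', h2.ne, h3.ne, h3.ne', h1.ne]) (by simp)
  simpa using this

lemma mem_of_quadrilateral {p q r t : V}
    (h : ∀ w : G.Walk p p, w.IsCycle → w.length ≤ 5 → ∀ e ∈ w.edges, e ∈ W)
    (h1 : G.Adj p q) (h2 : G.Adj q r) (h3 : G.Adj r t) (h4 : G.Adj t p)
    (hpr : p ≠ r) (hqt : q ≠ t) :
    s(p, q) ∈ W ∧ s(q, r) ∈ W ∧ s(r, t) ∈ W ∧ s(t, p) ∈ W := by
  have := h (.cons h1 (.cons h2 (.cons h3 (.cons h4 .nil))))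
    (by simp [Walk.cons_isCycle_iff, h1.ne', h2.ne, h3.ne, h4.ne, h4.ne', h1.ne,
      hpr, hpr.symm, hqt]) (by simp)
  simpa using this

lemma mem_of_pentagon {p q r t u : V}
    (h : ∀ w : G.Walk p p, w.IsCycle → w.length ≤ 5 → ∀ e ∈ w.edges, e ∈ W)
    (h1 : G.Adj p q) (h2 : G.Adj q r) (h3 : G.Adj r t) (h4 : G.Adj t u) (h5 : G.Adj u p)
    (hpr : p ≠ r) (hpt : p ≠ t) (hqt : q ≠ t) (hqu : q ≠ u) (hru : r ≠ u) : s(u, p) ∈ W := by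
  have := h (.cons h1 (.cons h2 (.cons h3 (.cons h4 (.cons h5 .nil)))))
    (by simp [Walk.cons_isCycle_iff, h1.ne', h2.ne, h3.ne, h4.ne, h5.ne, h5.ne', h1.ne,
      hpr, hpr.symm, hqt, hpt, hpt.symm, hqu, hru])
    (by simp)
  exact this _ (by simp)

/-- A closed segment of length at most `4` of a non-backtracking walk lies on a short cycle. -/
lemma mem_of_closed_segment {t : ℕ → V} (hadj : ∀ i, G.Adj (t i) (t (i + 1)))
    (hnb : ∀ i, t i ≠ t (i + 2))
    (h : ∀ i, ∀ w : G.Walk (t i) (t i), w.IsCycle → w.length ≤ 5 → ∀ e ∈ w.edges, e ∈ W)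
    {i d : ℕ} (hd : 1 ≤ d) (hd4 : d ≤ 4) (hi : t i = t (i + d)) {m : ℕ} (him : i ≤ m)
    (hmi : m < i + d) : s(t m, t (m + 1)) ∈ W := by
  obtain ⟨r, rfl⟩ := Nat.exists_eq_add_of_le him
  have h0 := hadj i
  have h1 := hadj (i + 1)
  have h2 := hadj (i + 2)
  have h3 := hadj (i + 3)
  interval_cases d
  · exact absurd hi h0.ne
  · exact absurd hi (hnb i)
  · rw [show i + 2 + 1 = i + 3 from rfl, ← hi] at h2
    obtain ⟨e0, e1, e2⟩ := mem_of_triangle (h i) h0 h1 h2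
    have : r < 3 := by omega
    interval_cases r
    exacts [e0, e1, by rwa [show i + 2 + 1 = i + 3 from rfl, ← hi]]
  · rw [show i + 3 + 1 = i + 4 from rfl, ← hi] at h3
    obtain ⟨e0, e1, e2, e3⟩ := mem_of_quadrilateral (h i) h0 h1 h2 h3 (hnb i) (hnb (i + 1))
    have : r < 4 := by omega
    interval_cases r
    exacts [e0, e1, e2, by rwa [show i + 3 + 1 = i + 4 from rfl, ← hi]]

/-- A chord spanning a segment of length at most `4` lies on a short cycle. -/
lemma mem_of_chord {t : ℕ → V} (hadj : ∀ i, G.Adj (t i) (t (i + 1)))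
    (hinj : ∀ i d, 1 ≤ d → d ≤ 4 → t i ≠ t (i + d))
    (h : ∀ i, ∀ w : G.Walk (t i) (t i), w.IsCycle → w.length ≤ 5 → ∀ e ∈ w.edges, e ∈ W)
    {i d : ℕ} (hd : 2 ≤ d) (hd4 : d ≤ 4) (hi : G.Adj (t i) (t (i + d))) :
    s(t i, t (i + d)) ∈ W := by
  have h0 := hadj i
  have h1 := hadj (i + 1)
  have h2 := hadj (i + 2)
  have h3 := hadj (i + 3)
  have n2 := hinj i 2 (by omega) (by omega)
  rw [Sym2.eq_swap]
  interval_cases d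
  · exact (mem_of_triangle (h i) h0 h1 hi.symm).2.2
  · exact (mem_of_quadrilateral (h i) h0 h1 h2 hi.symm n2
      (hinj (i + 1) 2 (by omega) (by omega))).2.2.2
  · exact mem_of_pentagon (h i) h0 h1 h2 h3 hi.symm n2 (hinj i 3 (by omega) (by omega))
      (hinj (i + 1) 2 (by omega) (by omega)) (hinj (i + 1) 3 (by omega) (by omega))
      (hinj (i + 2) 2 (by omega) (by omega))

end ShortCycles

section OuterCycle

/-- Let two cycles of lengths `6` and `n - 4` share the edge `s 0 s 5`, and let `s` traverse the
boundary of their union. If all short cycles through the vertices of `s` have their edges in the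
second cycle, then `s` does not repeat vertices. -/
lemma injOn_of_theta {G : SimpleGraph V} {W : Set (Sym2 V)} {s : ℕ → V} {n : ℕ} (hn7 : 7 ≤ n)
    (hn9 : n ≤ 9) (h0 : s n = s 0) (hadj : ∀ i < n, G.Adj (s i) (s (i + 1)))
    (h1 : Set.InjOn s (Set.Icc 0 5)) (h2 : Set.InjOn s (Set.Icc 5 n))
    (h46 : s 4 ≠ s 6) (h1n : s 1 ≠ s (n - 1))
    (hW : ∀ e ∈ W, e = s(s 0, s 5) ∨ ∃ m, 5 ≤ m ∧ m < n ∧ e = s(s m, s (m + 1)))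
    (h : ∀ i < n, ∀ w : G.Walk (s i) (s i), w.IsCycle → w.length ≤ 5 → ∀ e ∈ w.edges, e ∈ W) :
    Set.InjOn s (Set.Iio n) ∧ ∀ i < n, ∀ j < n, G.Adj (s i) (s j) →
      j = i + 1 ∨ i = j + 1 ∨ (i = 0 ∧ (j = 5 ∨ j + 1 = n)) ∨ (j = 0 ∧ (i = 5 ∨ i + 1 = n)) := by
  have i1 : ∀ i j, i ≤ 5 → j ≤ 5 → s i = s j → i = j := fun i j hi hj =>
    h1 ⟨i.zero_le, hi⟩ ⟨j.zero_le, hj⟩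
  have i2 : ∀ i j, 5 ≤ i → i ≤ n → 5 ≤ j → j ≤ n → s i = s j → i = j :=
    fun i j hi hi' hj hj' => h2 ⟨hi, hi'⟩ ⟨hj, hj'⟩
  have e45 : s(s 4, s 5) ∉ W := by
    intro he
    rcases hW _ he with he | ⟨m, hm5, hmn, he⟩ <;> rcases Sym2.eq_iff.1 he with ⟨a, b⟩ | ⟨a, b⟩
    · have := i1 _ _ (by omega) (by omega) a
      omega
    · have := i1 _ _ (by omega) (by omega) a
      omega
    · have := i2 _ _ (by omega) (by omega) (by omega) (by omega) b
      omega
    · obtain rfl := i2 _ _ (by omega) (by omega) (by omega) (by omega) b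
      exact h46 a
  have e01 : s(s 0, s 1) ∉ W := by
    intro he
    rcases hW _ he with he | ⟨m, hm5, hmn, he⟩ <;> rcases Sym2.eq_iff.1 he with ⟨a, b⟩ | ⟨a, b⟩
    · have := i1 _ _ (by omega) (by omega) b
      omega
    · have := i1 _ _ (by omega) (by omega) a
      omega
    · have := i2 _ _ (by omega) (by omega) (by omega) (by omega) (h0.trans a)
      omega
    · obtain rfl := i2 _ _ (by omega) (by omega) (by omega) (by omega) (h0.trans a)
      exact h1n b
  let t : ℕ → V := fun i => s (i % n)
  have ht : ∀ i < n, t i = s i := fun i hi => congrArg s (Nat.mod_eq_of_lt hi)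
  have htn : ∀ i, t (i + n) = t i := fun i => congrArg s (Nat.add_mod_right i n)
  have hmod : ∀ i d, d ≤ n → i % n + d < n ∧ (i + d) % n = i % n + d ∨
      n ≤ i % n + d ∧ (i + d) % n + n = i % n + d := by
    intro i d hd
    interval_cases n <;> omega
  have hlt : ∀ i, i % n < n := fun i => Nat.mod_lt _ (by omega)
  have hadj' : ∀ i, G.Adj (t i) (t (i + 1)) := by
    intro i
    have := hlt i
    rcases hmod i 1 (by omega) with ⟨-, hm⟩ | ⟨hge, hm⟩
    · simpa only [t, hm] using hadj _ (hlt i)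
    · have := hadj _ (hlt i)
      rwa [show i % n + 1 = n by omega, h0, show 0 = (i + 1) % n by omega] at this
  have hnb : ∀ i, t i ≠ t (i + 2) := by
    intro i heq
    have := hlt i
    simp only [t] at heq
    rcases hmod i 2 (by omega) with ⟨hl, hm⟩ | ⟨hge, hm⟩
    · rw [hm] at heq
      rcases lt_trichotomy (i % n) 4 with h4 | h4 | h4
      · have := i1 _ _ (by omega) (by omega) heq
        omega
      · rw [h4] at heq
        exact h46 heq
      · have := i2 _ _ (by omega) (by omega) (by omega) (by omega) heq
        omega
    · rcases hge.eq_or_lt with hge | hlt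
      · rw [show (i + 2) % n = 0 by omega, ← h0] at heq
        have := i2 _ _ (by omega) (by omega) (by omega) (by omega) heq
        omega
      · rw [show (i + 2) % n = 1 by omega, show i % n = n - 1 by omega] at heq
        exact h1n heq.symm
  have hshort : ∀ i, ∀ w : G.Walk (t i) (t i), w.IsCycle → w.length ≤ 5 → ∀ e ∈ w.edges, e ∈ W :=
    fun i => h _ (hlt i)
  have hinj : ∀ i j, i < j → j < n → s i ≠ s j := by
    intro i j hij hj heq
    by_cases hj5 : j ≤ 5
    · exact hij.ne (i1 _ _ (by omega) hj5 heq)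
    by_cases hi5 : 5 ≤ i
    · exact hij.ne (i2 _ _ hi5 (by omega) (by omega) (by omega) heq)
    by_cases hd : j - i ≤ 4
    · have := mem_of_closed_segment hadj' hnb hshort (i := i) (d := j - i) (m := 4) (by omega) hd
        (by rwa [show i + (j - i) = j by omega, ht i (by omega), ht j hj]) (by omega) (by omega)
      rw [ht _ (by omega), ht _ (by omega)] at this
      exact e45 this
    · rcases i.eq_zero_or_pos with rfl | hi
      · have := i2 _ _ (by omega) (by omega) (by omega) (by omega) (h0.trans heq)
        omega
      · have := mem_of_closed_segment hadj' hnb hshort (i := j) (d := i + n - j) (m := 0 + n)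
          (by omega) (by omega)
          (by rw [show j + (i + n - j) = i + n by omega, htn, ht i (by omega), ht j hj, heq])
          (by omega) (by omega)
        rw [htn, show 0 + n + 1 = 1 + n by omega, htn, ht _ (by omega), ht _ (by omega)] at this
        exact e01 this
  have hinj' : ∀ i < n, ∀ j < n, s i = s j → i = j := by
    intro i hi j hj heq
    rcases lt_trichotomy i j with h | h | h
    exacts [absurd heq (hinj _ _ h hj), h, absurd heq.symm (hinj _ _ h hi)]
  refine ⟨fun i hi j hj => hinj' i hi j hj, ?_⟩
  have htinj : ∀ i d, 1 ≤ d → d ≤ 4 → t i ≠ t (i + d) := by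
    intro i d hd hd4 heq
    have := hinj' _ (hlt _) _ (hlt _) heq
    have := hmod i d (by omega)
    omega
  have key : ∀ i j, i < j → j < n → G.Adj (s i) (s j) →
      j = i + 1 ∨ (i = 0 ∧ (j = 5 ∨ j + 1 = n)) := by
    intro i j hij hj hadjij
    by_contra hcon
    have hmem : s(s i, s j) ∈ W := by
      by_cases hd : j - i ≤ 4
      · have := mem_of_chord hadj' htinj hshort (i := i) (d := j - i) (by omega) hd
          (by rwa [show i + (j - i) = j by omega, ht i (by omega), ht j hj])
        rwa [show i + (j - i) = j by omega, ht i (by omega), ht j hj] at this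
      · have := mem_of_chord hadj' htinj hshort (i := j) (d := i + n - j) (by omega) (by omega)
          (by rw [show j + (i + n - j) = i + n by omega, htn, ht i (by omega), ht j hj]
              exact hadjij.symm)
        rwa [show j + (i + n - j) = i + n by omega, htn, ht i (by omega), ht j hj,
          Sym2.eq_swap] at this
    rcases hW _ hmem with he | ⟨m, hm5, hmn, he⟩
    · rcases Sym2.eq_iff.1 he with ⟨a, b⟩ | ⟨a, b⟩
      · have := hinj' _ (by omega) _ (by omega) a
        have := hinj' _ (by omega) _ (by omega) b
        omega
      · have := hinj' _ (by omega) _ (by omega) a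
        have := hinj' _ (by omega) _ (by omega) b
        omega
    · rcases (show m + 1 ≤ n from hmn).eq_or_lt with hm | hm
      · rw [hm, h0] at he
        rcases Sym2.eq_iff.1 he with ⟨a, b⟩ | ⟨a, b⟩
        · have := hinj' _ (by omega) _ (by omega) a
          have := hinj' _ (by omega) _ (by omega) b
          omega
        · have := hinj' _ (by omega) _ (by omega) a
          have := hinj' _ (by omega) _ (by omega) b
          omega
      · rcases Sym2.eq_iff.1 he with ⟨a, b⟩ | ⟨a, b⟩
        · have := hinj' _ (by omega) _ (by omega) a
          have := hinj' _ (by omega) _ (by omega) b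
          omega
        · have := hinj' _ (by omega) _ (by omega) a
          have := hinj' _ (by omega) _ (by omega) b
          omega
  intro i hi j hj hadjij
  rcases lt_trichotomy i j with h | h | h
  · have := key i j h hj hadjij
    omega
  · exact absurd (congrArg s h) hadjij.ne
  · have := key j i h hi hadjij.symm
    omega

lemma length_le_degree {G : SimpleGraph V} {v : V} [Fintype (G.neighborSet v)] {l : List V}
    (hl : l.Nodup) (hadj : ∀ z ∈ l, G.Adj v z) : l.length ≤ G.degree v := by
  classical
  rw [← card_neighborFinset_eq_degree, ← List.toFinset_card_of_nodup hl]
  exact Finset.card_le_card fun z hz =>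
    (mem_neighborFinset _ _ _).2 (hadj z (List.mem_toFinset.1 hz))

lemma eq_of_degree_le_length_add_one {G : SimpleGraph V} {v : V} [Fintype (G.neighborSet v)]
    {S : Set V} {l : List V} (hl : l.Nodup) (hadj : ∀ z ∈ l, G.Adj v z) (hS : ∀ z ∈ l, z ∈ S)
    (hdeg : G.degree v ≤ l.length + 1) :
    ∀ u ∉ S, ∀ u' ∉ S, G.Adj v u → G.Adj v u' → u = u' := by
  intro u hu u' hu' hvu hvu'
  by_contra huu
  have := length_le_degree (G := G) (v := v) (l := u :: u' :: l)
    (by simpa [hl, huu] using ⟨fun h => hu (hS u h), fun h => hu' (hS u' h)⟩)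
    (by simpa [hvu, hvu'] using hadj)
  simp only [List.length_cons] at this
  omega

end OuterCycle

/-- In a minimal counterexample `(G, C0, φ0)` to the extension
theorem, embedded in the plane so that the chordless cycle `C0` bounds the
outer face `D`, an internal `(3,3,3,3,3,4)`-face cannot share a `(3,4)`-edge
with an internal face of length at most `5` in which all vertices except the
common `4`-vertex are `3`-vertices. -/
theorem no_internal_334_sharing {V : Type} [Fintype V] [DecidableEq V]
    (G : SimpleGraph V) [DecidableRel G.Adj]
    {v0 : V} (C0 : G.Walk v0 v0) (φ0 : V → Bool)
    (hmin : IsMinimalCounterexample G C0 φ0)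
    (vtx : V → ℝ × ℝ) (arc : V → V → ℝ → ℝ × ℝ)
    (hemb : IsPlaneEmbedding G vtx arc)
    (hchordless : Chordless G C0)
    (D : Set (ℝ × ℝ)) (hD : IsOuterFace G vtx arc D)
    (hbound : frontier D = WalkDrawing G arc C0)
    -- `f1` is an internal `(3,3,3,3,3,4)`-face with boundary cycle `w1`:
    {a : V} (w1 : G.Walk a a) (f1 : Set (ℝ × ℝ))
    (hw1 : w1.IsCycle) (hl1 : w1.length = 6)
    (hf1 : FaceBoundedBy G vtx arc f1 w1)
    (hint1 : ∀ z ∈ w1.support, ¬ VertexOnFace vtx D z)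
    -- `f2` is an internal face of length at most `5` with boundary cycle `w2`:
    {b : V} (w2 : G.Walk b b) (f2 : Set (ℝ × ℝ))
    (hw2 : w2.IsCycle) (hl2 : w2.length ≤ 5)
    (hf2 : FaceBoundedBy G vtx arc f2 w2)
    (hint2 : ∀ z ∈ w2.support, ¬ VertexOnFace vtx D z)
    (hne : f1 ≠ f2)
    -- they share the `(3,4)`-edge `xy`, where `x` is the `4`-vertex:
    (x y : V) (he1 : s(x, y) ∈ w1.edges) (he2 : s(x, y) ∈ w2.edges)
    (hdx : G.degree x = 4) (hdy : G.degree y = 3)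
    -- all vertices of `f1` other than `x` are `3`-vertices:
    (h31 : ∀ z ∈ w1.support, z ≠ x → G.degree z = 3)
    -- all vertices of `f2` other than the `4`-vertex `x` are `3`-vertices:
    (h32 : ∀ z ∈ w2.support, z ≠ x → G.degree z = 3) :
    False := by
  obtain ⟨p, hp, hpl, hpxy, hpe, hps⟩ := exists_isPath_of_mem_edges_of_isCycle hw1 he1
  obtain ⟨q, hq, hql, hqxy, hqe, hqs⟩ := exists_isPath_of_mem_edges_of_isCycle hw2 he2
  have hadjxy : G.Adj x y := w1.adj_of_mem_edges he1
  have hl3 := hw2.three_le_length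
  obtain ⟨k, hk⟩ : ∃ k, q.length = k + 1 := ⟨q.length - 1, by omega⟩
  have hp5 : p.length = 5 := by omega
  -- the two faces leave the common edge along different edges
  have hsnd : p.snd ≠ q.snd := by
    intro heq
    have hd : ∀ d, G.Adj y d → d = p.snd ∨ d = x := fun d hd =>
      eq_or_eq_of_snd_eq_snd hemb hadjxy.symm hd hp hq (by rwa [Sym2.eq_swap]) heq hf1 hf2 hne
        (by simpa only [Sym2.eq_swap] using hpe) (by simpa only [Sym2.eq_swap] using hqe)
    have : G.degree y ≤ 2 := by
      rw [← card_neighborFinset_eq_degree]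
      refine (Finset.card_le_card fun z hz => ?_).trans (Finset.card_le_two (a := p.snd) (b := x))
      simpa using hd z ((mem_neighborFinset _ _ _).1 hz)
    omega
  have hpen : p.penultimate ≠ q.penultimate := by
    intro heq
    have hd : ∀ d, G.Adj x d → d = p.penultimate ∨ d = y := fun d hd => by
      simpa using eq_or_eq_of_snd_eq_snd hemb hadjxy hd hp.reverse hq.reverse (by simpa)
        (by simpa using heq) hf1 hf2 hne (by simpa using hpe) (by simpa using hqe)
    have : G.degree x ≤ 2 := by
      rw [← card_neighborFinset_eq_degree]
      refine (Finset.card_le_card fun z hz => ?_).trans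
        (Finset.card_le_two (a := p.penultimate) (b := y))
      simpa using hd z ((mem_neighborFinset _ _ _).1 hz)
    omega
  set s : ℕ → V := fun i => (p.reverse.append q).getVert i with hs
  have hsp : ∀ i ≤ 5, s i = p.getVert (5 - i) := by
    intro i hi
    simp only [hs, Walk.getVert_append, Walk.length_reverse, hp5, Walk.getVert_reverse]
    rcases hi.eq_or_lt with rfl | hi
    · simp
    · simp [hi]
  have hsq : ∀ i, 5 ≤ i → s i = q.getVert (i - 5) := by
    intro i hi
    simp [hs, Walk.getVert_append, hp5, hi.not_gt]
  have hs0 : s 0 = x := by simp [hs]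
  have hs5 : s 5 = y := by simp [hsq 5 le_rfl]
  have hsn : s (6 + k) = x := by
    rw [hsq _ (by omega), show 6 + k - 5 = q.length by omega, Walk.getVert_length]
  have hadj : ∀ i < 6 + k, G.Adj (s i) (s (i + 1)) := fun i hi =>
    Walk.adj_getVert_succ _ (by rw [Walk.length_append, Walk.length_reverse]; omega)
  clear_value s
  clear hs
  have hmem1 : ∀ i ≤ 5, s i ∈ w1.support := fun i hi =>
    (hps _).2 (hsp i hi ▸ p.getVert_mem_support _)
  have hmem2 : ∀ i, 5 ≤ i → s i ∈ w2.support := fun i hi =>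
    (hqs _).2 (hsq i hi ▸ q.getVert_mem_support _)
  have hx2 : s 0 ∈ w2.support := hs0.trans hsn.symm ▸ hmem2 _ (by omega)
  have hnear : ∀ i < 6 + k, ∃ z ∈ w2.support, G.dist (s i) z ≤ 2 := by
    intro i hi
    have d1 : ∀ {u v : V}, G.Adj u v → G.dist u v ≤ 1 := fun h => dist_le h.toWalk
    have d2 : ∀ {u v w : V}, G.Adj u v → G.Adj v w → G.dist u w ≤ 2 :=
      fun h h' => dist_le (Walk.cons h h'.toWalk)
    by_cases h5 : 5 ≤ i
    · exact ⟨s i, hmem2 i h5, by simp⟩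
    have := hmem2 5 le_rfl
    interval_cases i
    · exact ⟨s 0, hx2, by simp⟩
    · exact ⟨s 0, hx2, (d1 (hadj 0 (by omega)).symm).trans (by omega)⟩
    · exact ⟨s 0, hx2, d2 (hadj 1 (by omega)).symm (hadj 0 (by omega)).symm⟩
    · exact ⟨s 5, this, d2 (hadj 3 (by omega)) (hadj 4 (by omega))⟩
    · exact ⟨s 5, this, (d1 (hadj 4 (by omega))).trans (by omega)⟩
  have hshort : ∀ i < 6 + k, ∀ w : G.Walk (s i) (s i), w.IsCycle → w.length ≤ 5 →
      ∀ e ∈ w.edges, e ∈ {e | e ∈ w2.edges} := by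
    intro i hi w hw hl e he
    obtain ⟨z, hz, hd⟩ := hnear i hi
    by_contra hcon
    have := hmin.1.2.1 w w2 hw hw2 hl hl2 (fun heq => hcon (heq ▸ he)) _ w.start_mem_support _ hz
    omega
  obtain ⟨hinj, hchord⟩ := injOn_of_theta (n := 6 + k) (by omega) (by omega) (hsn.trans hs0.symm)
    hadj (fun i hi j hj h => by
      rw [hsp i hi.2, hsp j hj.2] at h
      have := hp.getVert_injOn (Set.mem_ofPred.2 (by omega)) (Set.mem_ofPred.2 (by omega)) h
      have := hi.2
      have := hj.2
      omega)
    (fun i hi j hj h => by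
      have := hi.1
      have := hj.1
      have := hi.2
      have := hj.2
      rw [hsq i hi.1, hsq j hj.1] at h
      have := hq.getVert_injOn (Set.mem_ofPred.2 (by omega)) (Set.mem_ofPred.2 (by omega)) h
      omega)
    (by rw [hsp 4 (by omega), hsq 6 (by omega)]; exact hsnd)
    (by rw [hsp 1 (by omega), hsq _ (by omega), show 6 + k - 1 - 5 = q.length - 1 by omega]
        simpa [Walk.penultimate, hp5] using hpen)
    (fun e he => by
      rcases (hqe e).1 he with rfl | he
      · exact Or.inl (by rw [hs0, hs5])
      · obtain ⟨u, v⟩ := e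
        obtain ⟨j, hj, hjuv⟩ := q.mk_mem_edges_iff_exists.1 he
        refine Or.inr ⟨5 + j, by omega, by omega, ?_⟩
        rw [hsq _ (by omega), hsq _ (by omega), show 5 + j + 1 - 5 = j + 1 by omega,
          Nat.add_sub_cancel_left]
        exact hjuv.symm)
    hshort
  have hinj' : ∀ i < 6 + k, ∀ j < 6 + k, s i = s j → i = j := fun i hi j hj => hinj hi hj
  have hC0 : ∀ z ∈ C0.support, VertexOnFace vtx D z := by
    intro z hz
    obtain ⟨⟨u, v⟩, he, hze⟩ :=
      (Walk.mem_support_iff_exists_mem_edges_of_not_nil hmin.1.2.2.1.1.not_nil).1 hz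
    have huv : G.Adj u v := C0.adj_of_mem_edges he
    rw [VertexOnFace, hbound]
    refine mem_walkDrawing.2 ⟨u, v, huv, he, ?_⟩
    rcases Sym2.mem_iff.1 hze with rfl | rfl
    exacts [hemb.left_mem_arcImage huv, hemb.right_mem_arcImage huv]
  have hQ : ∀ i < 6 + k, s i ∉ {z | z ∈ C0.support} := by
    intro i _ hz
    rcases le_total i 5 with h5 | h5
    exacts [hint1 _ (hmem1 i h5) (hC0 _ hz), hint2 _ (hmem2 i h5) (hC0 _ hz)]
  let S : Set V := {z | ∃ i < 6 + k, s i = z}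
  have hsS : ∀ i < 6 + k, s i ∈ S := fun i hi => ⟨i, hi, rfl⟩
  have hdeg : ∀ i < 6 + k, i ≠ 0 → G.degree (s i) = 3 := by
    intro i hi h0
    have hx : s i ≠ x := fun h => h0 (hinj' i hi 0 (by omega) (h.trans hs0.symm))
    rcases le_total i 5 with h5 | h5
    exacts [h31 _ (hmem1 i h5) hx, h32 _ (hmem2 i h5) hx]
  have hadj05 : G.Adj (s 0) (s 5) := by rwa [hs0, hs5]
  have hadjn : G.Adj (s (5 + k)) (s 0) := by
    simpa only [show 5 + k + 1 = 6 + k by omega, hsn, hs0] using hadj (5 + k) (by omega)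
  have hne' : ∀ {i j}, i < 6 + k → j < 6 + k → i ≠ j → s i ≠ s j :=
    fun hi hj hij h => hij (hinj' _ hi _ hj h)
  have hout : ∀ i < 6 + k, ∀ u ∉ S, ∀ u' ∉ S, G.Adj (s i) u → G.Adj (s i) u' → u = u' := by
    intro i hi
    rcases i.eq_zero_or_pos with rfl | hi0
    · refine eq_of_degree_le_length_add_one (l := [s 1, s 5, s (5 + k)]) ?_ ?_ ?_
        (hs0 ▸ hdx.le)
      · have h15 := hne' (i := 1) (j := 5) (by omega) (by omega) (by omega)
        have h1n := hne' (i := 1) (j := 5 + k) (by omega) (by omega) (by omega)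
        have h5n := hne' (i := 5) (j := 5 + k) (by omega) (by omega) (by omega)
        simp [h15, h1n, h5n]
      · simp [hadj 0 (by omega), hadj05, hadjn.symm]
      · simpa using ⟨hsS 1 (by omega), hsS 5 (by omega), hsS (5 + k) (by omega)⟩
    · have hpred : G.Adj (s i) (s (i - 1)) := by
        simpa only [Nat.sub_add_cancel hi0] using (hadj (i - 1) (by omega)).symm
      obtain ⟨j, hj, hij, hji⟩ : ∃ j < 6 + k, G.Adj (s i) (s j) ∧ i - 1 ≠ j := by
        rcases (show i + 1 ≤ 6 + k by omega).eq_or_lt with hl | hl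
        · obtain rfl : i = 5 + k := by omega
          exact ⟨0, by omega, hadjn, by omega⟩
        · exact ⟨i + 1, hl, hadj i hi, by omega⟩
      refine eq_of_degree_le_length_add_one (l := [s (i - 1), s j]) ?_ ?_ ?_
        (by simp [hdeg i hi hi0.ne'])
      · simpa using hne' (by omega) hj hji
      · simp [hpred, hij]
      · simpa using ⟨hsS _ (by omega), hsS _ hj⟩
  have hk3 : k ∈ [1, 2, 3] := by
    have : k = 1 ∨ k = 2 ∨ k = 3 := by omega
    simpa
  have h5 : ∀ u ∉ S, ¬ G.Adj (s 5) u := by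
    intro u hu hadju
    have := length_le_degree (G := G) (v := s 5) (l := [u, s 0, s 4, s 6])
      (by
        have hu' : ∀ i < 6 + k, u ≠ s i := fun i hi h => hu (h ▸ hsS i hi)
        have h04 := hne' (i := 0) (j := 4) (by omega) (by omega) (by omega)
        have h06 := hne' (i := 0) (j := 6) (by omega) (by omega) (by omega)
        have h46 := hne' (i := 4) (j := 6) (by omega) (by omega) (by omega)
        simp [hu' 0 (by omega), hu' 4 (by omega), hu' 6 (by omega), h04, h06, h46])
      (by simp [hadju, hadj05.symm, (hadj 4 (by omega)).symm, hadj 5 (by omega)])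
    rw [hdeg 5 (by omega) (by omega)] at this
    simp at this
  have he12 : s(s 1, s 2) ∈ w1.edges := by
    refine (hpe _).2 (Or.inr ?_)
    rw [hsp 1 (by omega), hsp 2 (by omega), Sym2.eq_swap]
    exact p.mk_mem_edges_iff_exists.2 ⟨3, by omega, rfl⟩
  obtain ⟨c, hc, hcφ⟩ := hmin.exists_super_deleteEdges hw1 he12
    fun h => hQ 1 (by omega) (C0.fst_mem_support_of_mem_edges h)
  have hchorded : ∀ i < 6 + k, ∀ j < 6 + k, G.Adj (s i) (s j) → chordedAdj k i j = true := by
    intro i hi j hj hij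
    have := hchord i hi j hj hij
    simp only [chordedAdj, Bool.or_eq_true, Bool.and_eq_true, Nat.beq_eq]
    omega
  obtain ⟨c', hc', hcc⟩ := exists_superIFColoring_of_chorded hk3 hchorded hQ (S := S)
    (fun z => Iff.rfl) hout h5 (hsS 1 (by omega)) (hsS 2 (by omega)) hc
  refine hmin.1.2.2.2.2.2 ⟨c', hc', fun z hz => (hcc z ?_).trans (hcφ z hz)⟩
  rintro ⟨i, hi, rfl⟩
  exact hQ i hi hz

end IFPaper
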